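/- For every integer s < 0 and every d ≥ 0, S_d(s) = 0 if and only if d > L_{−s}. -/

import Mathlib

open Polynomial

/-- The power sum `S_d(-k) = ∑_{a monic, deg a = d} a^k`, written as a sum over the
lower-order coefficients of the monic polynomial. -/
noncomputable def powerSum (Fq : Type) [Field Fq] [Fintype Fq] (d k : ℕ) : Polynomial Fq :=
  ∑ c : Fin d → Fq, (X ^ d + ∑ i : Fin d, C (c i) * X ^ (i : ℕ)) ^ k

/-- `m` sums to `k` with no carrying of digits in base `p`. -/
def NoCarry (p : ℕ) {n : ℕ} (m : Fin n → ℕ) (k : ℕ) : Prop :=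
  (∑ i, m i) = k ∧ ∀ j : ℕ, (∑ i, m i / p ^ j % p) = k / p ^ j % p

/-- The set `U_d(k)`. -/
def Uset (p q d k : ℕ) : Set (Fin (d + 1) → ℕ) :=
  {m | NoCarry p m k ∧ ∀ i : Fin (d + 1), 0 < (i : ℕ) → 0 < m i ∧ (q - 1) ∣ m i}

/-- The weight of an element of `U_d(k)`. -/
def wtU {d : ℕ} (m : Fin (d + 1) → ℕ) : ℕ :=
  ∑ i : Fin (d + 1), (d - (i : ℕ)) * m i

/-- Strict lexicographic order on tuples. -/
def LexLT {n : ℕ} (x y : Fin n → ℕ) : Prop :=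
  ∃ i, (∀ j, j < i → x j = y j) ∧ x i < y i

/-- Lexicographic order on tuples. -/
def LexLE {n : ℕ} (x y : Fin n → ℕ) : Prop := x = y ∨ LexLT x y

/-- `L_k := min_{0 ≤ i < f} l(k p^i)/(q-1)` where `l` is the base-`q` digit sum, `q = p^f`. -/
noncomputable def Lval (p f k : ℕ) (hf : 0 < f) : ℚ :=
  (Finset.range f).inf' ⟨0, Finset.mem_range.mpr hf⟩
    (fun i => ((Nat.digits (p ^ f) (k * p ^ i)).sum : ℚ) / ((p : ℚ) ^ f - 1))

/-- The set `W_d(N)` of compositions. -/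
def Wset (p q d N : ℕ) : Set (Fin d → ℕ) :=
  {Y | NoCarry p Y N ∧ ∀ i : Fin d, (i : ℕ) + 1 < d → 0 < Y i ∧ (q - 1) ∣ Y i}

/-- The weight of a composition. -/
def wtW {d : ℕ} (Y : Fin d → ℕ) : ℕ := ∑ i : Fin d, ((i : ℕ) + 1) * Y i

/-- `X` is the modest (lexicographically largest) composition in `W_d(N)`. -/
def Modest (p q : ℕ) {d : ℕ} (N : ℕ) (X : Fin d → ℕ) : Prop :=
  X ∈ Wset p q d N ∧ ∀ Y ∈ Wset p q d N, LexLE Y X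

/-- `X` is an optimal (minimum weight) composition in `W_d(N)`. -/
def Optimal (p q : ℕ) {d : ℕ} (N : ℕ) (X : Fin d → ℕ) : Prop :=
  X ∈ Wset p q d N ∧ ∀ Y ∈ Wset p q d N, wtW X ≤ wtW Y

/-- `Γ(n) : Fin f → ℕ`, summing the base-`p` digits of `n` in each residue class mod `f`. -/
def Gamma (p f n : ℕ) : Fin f → ℕ :=
  fun i => ∑ j ∈ Finset.range (Nat.log p n + 1), if j % f = (i : ℕ) then n / p ^ j % p else 0

/-- The cyclic matrix `E`, as a map: `(E x)_i = p x_{i+1} - x_i`, indices mod `f`. -/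
def Emap (p : ℕ) {R : Type} [Ring R] {f : ℕ} (x : Fin f → R) : Fin f → R :=
  fun i => (p : R) * x ⟨((i : ℕ) + 1) % f, Nat.mod_lt _ i.pos⟩ - x i

/-- `𝔍 = {Γ(n) : n > 0 is q-even}`, where `q = p ^ f`. -/
def Jfrak (p f : ℕ) : Set (Fin f → ℕ) :=
  {w | ∃ n : ℕ, 0 < n ∧ (p ^ f - 1) ∣ n ∧ Gamma p f n = w}

/-- `I_d`. -/
def Iset (p f d : ℕ) : Set (Fin f → ℕ) :=
  {u | (∃ n : ℕ, 0 < n ∧ Gamma p f n = u) ∧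
    ∃ v : Fin (d - 1) → Fin f → ℕ, (∀ j, v j ∈ Jfrak p f) ∧ (∑ j, v j) < u}

/-- `J_d`. -/
def Jset (p f d : ℕ) : Set (Fin f → ℕ) :=
  if d = 0 then ∅ else Jfrak p f ∩ (Iset p f d \ Iset p f (d + 1))

/-- A composition is `τ`-monotonic. -/
def TauMonotonic (p f : ℕ) {d : ℕ} (X : Fin d → ℕ) : Prop :=
  ∀ i j : Fin d, i < j → ∀ m n : ℕ, X i / p ^ m % p ≠ 0 → X j / p ^ n % p ≠ 0 →
    m % f = n % f → n ≤ m

/-- `W_d^B(N)`: compositions in `W_d(N)` whose `Γ`-matrix is `B`. -/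
def WBset (p f d N : ℕ) (B : Fin d → Fin f → ℕ) : Set (Fin d → ℕ) :=
  {Y | Y ∈ Wset p (p ^ f) d N ∧ ∀ j, Gamma p f (Y j) = B j}

/-- The multizeta value `ζ(-k_1, …, -k_r)` as a (finite) sum over strictly
decreasing tuples of degrees. -/
noncomputable def multizeta (Fq : Type) [Field Fq] [Fintype Fq] {r : ℕ} (k : Fin r → ℕ) :
    Polynomial Fq :=
  ∑ᶠ (dt : Fin r → ℕ) (_ : StrictAnti dt), ∏ i, powerSum Fq (dt i) (k i)


namespace PS
set_option linter.unusedSectionVars false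
section comb
variable {f : ℕ} [NeZero f]

/-- the cyclic operator `E`. -/
def ee (p : ℕ) (x : ZMod f → ℤ) (i : ZMod f) : ℤ := p * x (i + 1) - x i

/-- cost of the `u` cheapest units of class `i`. -/
def gg (p : ℕ) (pos : ZMod f → ℕ → ℕ) (i : ZMod f) (u : ℤ) : ℤ :=
  ∑ ρ ∈ Finset.range u.toNat, (p : ℤ) ^ (pos i ρ)

def FF (p : ℕ) (pos : ZMod f → ℕ → ℕ) (x : ZMod f → ℤ) : ℤ := ∑ i, gg p pos i (ee p x i)

structure Good (p : ℕ) (pos : ZMod f → ℕ → ℕ) : Prop where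
  hp : 2 ≤ p
  mono : ∀ i, Monotone (pos i)
  cls : ∀ i ρ, ((pos i ρ : ℕ) : ZMod f) = i
  gap : ∀ i ρ, pos i ρ + f ≤ pos i (ρ + (p - 1))

structure Feas (p d : ℕ) (y : ℕ → ZMod f → ℤ) : Prop where
  zero : y 0 = 0
  step : ∀ r < d, ∀ i, y r i + 1 ≤ y (r + 1) i
  nonneg : ∀ r ≤ d, ∀ i, 0 ≤ ee p (y r) i

def cost (p d : ℕ) (pos : ZMod f → ℕ → ℕ) (y : ℕ → ZMod f → ℤ) : ℤ :=
  ∑ r ∈ Finset.range (d + 1), FF p pos (y r)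

variable {p : ℕ} {pos : ZMod f → ℕ → ℕ}

lemma gg_nonneg (i : ZMod f) (u : ℤ) : 0 ≤ gg p pos i u := by
  unfold gg; positivity

lemma gg_mono (i : ZMod f) {u v : ℤ} (h : u ≤ v) : gg p pos i u ≤ gg p pos i v := by
  unfold gg
  apply Finset.sum_le_sum_of_subset_of_nonneg
  · intro a; simp only [Finset.mem_range]; omega
  · intros; positivity

lemma gg_succ (i : ZMod f) {u : ℤ} (h : 0 ≤ u) :
    gg p pos i (u + 1) = gg p pos i u + (p : ℤ) ^ (pos i u.toNat) := by
  unfold gg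
  rw [show (u + 1).toNat = u.toNat + 1 by omega, Finset.sum_range_succ]

lemma gg_zero (i : ZMod f) : gg p pos i 0 = 0 := by simp [gg]

lemma gg_conv_nat (hG : Good p pos) (i : ZMod f) (a e c : ℕ) :
    gg p pos i (a + e : ℕ) + gg p pos i (a + c : ℕ) ≤ gg p pos i a + gg p pos i (a + e + c : ℕ) := by
  induction e with
  | zero => simp
  | succ e ih =>
    have h1 := gg_succ (p := p) (pos := pos) i (u := ((a + e : ℕ) : ℤ)) (by positivity)
    have h2 := gg_succ (p := p) (pos := pos) i (u := ((a + e + c : ℕ) : ℤ)) (by positivity)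
    rw [show ((a + (e + 1) : ℕ) : ℤ) = ((a + e : ℕ) : ℤ) + 1 by push_cast; ring, h1,
      show ((a + (e + 1) + c : ℕ) : ℤ) = ((a + e + c : ℕ) : ℤ) + 1 by push_cast; ring, h2]
    have : (p : ℤ) ^ (pos i (a + e)) ≤ (p : ℤ) ^ (pos i (a + e + c)) := by
      apply pow_le_pow_right₀
      · have := hG.hp; exact_mod_cast (by omega : 1 ≤ p)
      · exact hG.mono i (by omega)
    simp only [Int.toNat_natCast]
    linarith

/-- convexity in exchange form -/
lemma gg_conv (hG : Good p pos) (i : ZMod f) {a b e : ℤ} (ha : 0 ≤ a) (he : 0 ≤ e) (hb : e ≤ b - a) :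
    gg p pos i (a + e) + gg p pos i (b - e) ≤ gg p pos i a + gg p pos i b := by
  obtain ⟨a', rfl⟩ := Int.eq_ofNat_of_zero_le ha
  obtain ⟨e', rfl⟩ := Int.eq_ofNat_of_zero_le he
  obtain ⟨c', hc⟩ := Int.eq_ofNat_of_zero_le (show 0 ≤ b - a' - e' by linarith)
  obtain rfl : b = a' + e' + c' := by linarith
  have := gg_conv_nat hG i a' e' c'
  push_cast at this
  rw [show (a' : ℤ) + e' + c' - e' = a' + c' by ring]
  exact this

/-- exchange, sign free -/
lemma gg_conv' (hG : Good p pos) (i : ZMod f) {a b e : ℤ} (ha : 0 ≤ a) (hb : 0 ≤ b)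
    (h : (0 ≤ e ∧ e ≤ b - a) ∨ (e ≤ 0 ∧ b - a ≤ e)) :
    gg p pos i (a + e) + gg p pos i (b - e) ≤ gg p pos i a + gg p pos i b := by
  rcases h with ⟨h1, h2⟩ | ⟨h1, h2⟩
  · exact gg_conv hG i ha h1 h2
  · have := gg_conv hG i (a := b) (b := a) (e := -e) hb (by linarith) (by linarith)
    rw [show b + -e = b - e by ring, show a - -e = a + e by ring] at this
    linarith

lemma FF_nonneg (x : ZMod f → ℤ) : 0 ≤ FF p pos x := by
  unfold FF; exact Finset.sum_nonneg fun i _ => gg_nonneg i _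

lemma cost_nonneg (d : ℕ) (y : ℕ → ZMod f → ℤ) : 0 ≤ cost p d pos y := by
  unfold cost; exact Finset.sum_nonneg fun i _ => FF_nonneg _

/-- Minimal solutions. -/
lemma minL (hp : 2 ≤ p) (s base top : ZMod f → ℤ) (hbt : ∀ j, base j ≤ top j)
    (htop : ∀ j, ee p top j ≤ s j) :
    ∃ η : ZMod f → ℤ, (∀ j, base j ≤ η j) ∧ (∀ j, η j ≤ top j) ∧ (∀ j, ee p η j ≤ s j) ∧
      ∀ j, η j = base j ∨ ee p η j = s j := by
  classical
  let m : (ZMod f → ℤ) → ℕ := fun η => (∑ j, (η j - base j)).toNat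
  obtain ⟨η, ⟨h1, h2, h3⟩, hmin⟩ := (measure m).wf.has_min
    {η | (∀ j, base j ≤ η j) ∧ (∀ j, η j ≤ top j) ∧ (∀ j, ee p η j ≤ s j)} ⟨top, hbt, fun _ => le_rfl, htop⟩
  refine ⟨η, h1, h2, h3, fun j => ?_⟩
  by_contra hcon
  push Not at hcon
  obtain ⟨hc1, hc2⟩ := hcon
  have hj1 : base j < η j := lt_of_le_of_ne (h1 j) (Ne.symm hc1)
  have hj2 : ee p η j < s j := lt_of_le_of_ne (h3 j) hc2
  let η' : ZMod f → ℤ := Function.update η j (η j - 1)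
  have hle : ∀ i, η' i ≤ η i := by
    intro i; simp only [η', Function.update_apply]; split_ifs with h
    · subst h; linarith
    · exact le_rfl
  have hb' : ∀ i, base i ≤ η' i := by
    intro i; simp only [η', Function.update_apply]; split_ifs with h
    · subst h; linarith
    · exact h1 i
  have hp0 : (0 : ℤ) ≤ p := by positivity
  apply hmin η' ⟨hb', fun i => (hle i).trans (h2 i), ?_⟩
  · change m η' < m η
    have hlt : ∑ i, (η' i - base i) < ∑ i, (η i - base i) := by
      apply Finset.sum_lt_sum
      · intro i _; linarith [hle i]
      · exact ⟨j, Finset.mem_univ _, by simp [η']⟩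
    have h0 : 0 ≤ ∑ i, (η' i - base i) := Finset.sum_nonneg fun i _ => by linarith [hb' i]
    simp only [m]; omega
  · intro i
    by_cases hij : i = j
    · subst hij
      have : ee p η' i ≤ ee p η i + 1 := by
        unfold ee
        have := mul_le_mul_of_nonneg_left (hle (i + 1)) hp0
        have h4 : η' i = η i - 1 := by simp [η']
        linarith
      linarith
    · have : ee p η' i ≤ ee p η i := by
        unfold ee
        have := mul_le_mul_of_nonneg_left (hle (i + 1)) hp0
        have h4 : η' i = η i := by simp [η', hij]
        linarith
      exact this.trans (h3 i)

lemma ee_sub (x y : ZMod f → ℤ) (j : ZMod f) : ee p (fun i => x i - y i) j = ee p x j - ee p y j := by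
  unfold ee; ring

lemma ee_add (x y : ZMod f → ℤ) (j : ZMod f) : ee p (fun i => x i + y i) j = ee p x j + ee p y j := by
  unfold ee; ring

/-- Maximal elements below a cap. -/
lemma maxL (hp : 2 ≤ p) (x cap : ZMod f → ℤ) (hx : ∀ j, x j ≤ cap j) (hex : ∀ j, 0 ≤ ee p x j) :
    ∃ a : ZMod f → ℤ, (∀ j, x j ≤ a j) ∧ (∀ j, a j ≤ cap j) ∧ (∀ j, 0 ≤ ee p a j) ∧
      ∀ j, a j = cap j ∨ ee p a j = 0 := by
  obtain ⟨η, h1, h2, h3, h4⟩ := minL hp (ee p cap) (fun _ => 0) (fun j => cap j - x j)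
    (fun j => by linarith [hx j]) (fun j => by rw [ee_sub]; linarith [hex j])
  refine ⟨fun j => cap j - η j, fun j => by linarith [h2 j], fun j => by linarith [h1 j],
    fun j => by rw [ee_sub]; linarith [h3 j], fun j => ?_⟩
  rcases h4 j with h | h
  · left; simp [h]
  · right; rw [ee_sub]; linarith

lemma sumS_aux (hG : Good p pos) (K : ℕ) : ∀ U : ZMod f → ℕ, (∀ j, ∀ ρ < U j, pos j ρ < K) →
    ∑ j, ∑ ρ ∈ Finset.range (U j), (p : ℤ) ^ (pos j ρ) < (p : ℤ) ^ K := by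
  classical
  have hp := hG.hp
  induction K with
  | zero =>
    intro U hU
    have : ∀ j, U j = 0 := by
      intro j; by_contra h
      exact absurd (hU j 0 (by omega)) (by omega)
    simp [this]
  | succ K ih =>
    intro U hU
    let j0 : ZMod f := (K : ZMod f)
    let U' : ZMod f → ℕ := Function.update U j0 (U j0 - (p - 1))
    have hU' : ∀ j, ∀ ρ < U' j, pos j ρ < K := by
      intro j ρ hρ
      by_cases hj : j = j0
      · subst hj
        simp only [U', Function.update_self] at hρ
        have h1 := hU j0 (ρ + (p - 1)) (by omega)
        have h2 := hG.gap j0 ρ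
        have : 0 < f := Nat.pos_of_ne_zero (NeZero.ne f)
        omega
      · simp only [U', Function.update_of_ne hj] at hρ
        have h1 := hU j ρ hρ
        have h2 : pos j ρ ≠ K := by
          intro h
          exact hj (by rw [← hG.cls j ρ, h])
        omega
    have h1 := ih U' hU'
    have hle : ∀ j, ∑ ρ ∈ Finset.range (U j), (p : ℤ) ^ (pos j ρ) ≤
        ∑ ρ ∈ Finset.range (U' j), (p : ℤ) ^ (pos j ρ) + if j = j0 then ((p : ℤ) - 1) * (p : ℤ) ^ K else 0 := by
      intro j
      by_cases hj : j = j0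
      · subst hj
        simp only [if_true]
        have hU'j : U' j0 = U j0 - (p - 1) := by simp [U']
        rw [← Finset.sum_range_add_sum_Ico _ (show U' j0 ≤ U j0 by omega)]
        have : ∑ ρ ∈ Finset.Ico (U' j0) (U j0), (p : ℤ) ^ (pos j0 ρ) ≤
            (Finset.Ico (U' j0) (U j0)).card • (p : ℤ) ^ K := by
          apply Finset.sum_le_card_nsmul
          intro ρ hρ
          apply pow_le_pow_right₀ (by exact_mod_cast (by omega : 1 ≤ p))
          have := hU j0 ρ (Finset.mem_Ico.mp hρ).2
          omega
        have hc : ((Finset.Ico (U' j0) (U j0)).card : ℤ) ≤ (p : ℤ) - 1 := by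
          rw [Nat.card_Ico]; omega
        rw [nsmul_eq_mul] at this
        have h2 : ((Finset.Ico (U' j0) (U j0)).card : ℤ) * (p : ℤ) ^ K ≤ ((p : ℤ) - 1) * (p : ℤ) ^ K :=
          mul_le_mul_of_nonneg_right hc (by positivity)
        linarith
      · have : U' j = U j := by simp [U', hj]
        simp [this, hj]
    have h3 := Finset.sum_le_sum fun j (_ : j ∈ Finset.univ) => hle j
    rw [Finset.sum_add_distrib, Finset.sum_ite_eq' Finset.univ j0] at h3
    simp only [Finset.mem_univ, if_true] at h3
    rw [pow_succ]
    linarith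

lemma sumS (hG : Good p pos) (a J : ℕ) (U : ZMod f → ℕ) (hU : ∀ j, ∀ ρ < U j, pos j ρ + a ≤ J) :
    (∑ j, ∑ ρ ∈ Finset.range (U j), (p : ℤ) ^ (pos j ρ)) * (p : ℤ) ^ a < (p : ℤ) ^ (J + 1) := by
  have hp := hG.hp
  by_cases ha : a ≤ J
  · have := sumS_aux hG (J + 1 - a) U (fun j ρ h => by have := hU j ρ h; omega)
    calc _ < (p : ℤ) ^ (J + 1 - a) * (p : ℤ) ^ a := by
            apply mul_lt_mul_of_pos_right this; positivity
      _ = _ := by rw [← pow_add]; congr 1; omega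
  · have : ∀ j, U j = 0 := by
      intro j; by_contra h
      have := hU j 0 (by omega)
      omega
    simp only [this, Finset.range_zero, Finset.sum_empty, Finset.sum_const_zero, zero_mul]
    positivity

end comb
end PS

namespace PS
set_option linter.unusedSectionVars false
section comb
variable {f : ℕ} [NeZero f] {p : ℕ} {pos : ZMod f → ℕ → ℕ}

lemma FF_submod (hG : Good p pos) (x z : ZMod f → ℤ) (hx : ∀ j, 0 ≤ ee p x j) (hz : ∀ j, 0 ≤ ee p z j) :
    FF p pos (fun j => min (x j) (z j)) + FF p pos (fun j => max (x j) (z j)) ≤ FF p pos x + FF p pos z := by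
  unfold FF
  rw [← Finset.sum_add_distrib, ← Finset.sum_add_distrib]
  apply Finset.sum_le_sum
  intro i _
  have h1 := hx i
  have h2 := hz i
  have hp0 : (0 : ℤ) ≤ p := by positivity
  unfold ee at *
  simp only
  rcases le_total (x (i + 1)) (z (i + 1)) with h3 | h3 <;> rcases le_total (x i) (z i) with h4 | h4 <;>
    simp only [min_eq_left h3, max_eq_right h3, min_eq_right h3, max_eq_left h3,
      min_eq_left h4, max_eq_right h4, min_eq_right h4, max_eq_left h4]
  · exact le_rfl
  · have h5 := mul_le_mul_of_nonneg_left h3 hp0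
    have := gg_conv hG i (a := p * x (i + 1) - x i) (b := p * z (i + 1) - z i) (e := x i - z i) h1
      (by linarith) (by linarith)
    rw [show (p * x (i + 1) - x i + (x i - z i) : ℤ) = p * x (i + 1) - z i by ring,
      show (p * z (i + 1) - z i - (x i - z i) : ℤ) = p * z (i + 1) - x i by ring] at this
    exact this
  · have h5 := mul_le_mul_of_nonneg_left h3 hp0
    have := gg_conv hG i (a := p * z (i + 1) - z i) (b := p * x (i + 1) - x i) (e := z i - x i) h2
      (by linarith) (by linarith)
    rw [add_comm (gg p pos i (p * x (i + 1) - x i))]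
    rw [show (p * z (i + 1) - z i + (z i - x i) : ℤ) = p * z (i + 1) - x i by ring,
      show (p * x (i + 1) - x i - (z i - x i) : ℤ) = p * x (i + 1) - z i by ring] at this
    exact this
  · rw [add_comm]

lemma ee_min (x z : ZMod f → ℤ) (j : ZMod f) (hx : 0 ≤ ee p x j) (hz : 0 ≤ ee p z j) :
    0 ≤ ee p (fun j => min (x j) (z j)) j := by
  unfold ee at *
  simp only
  rcases le_total (x (j + 1)) (z (j + 1)) with h3 | h3
  · rw [min_eq_left h3]; linarith [min_le_left (x j) (z j)]
  · rw [min_eq_right h3]; linarith [min_le_right (x j) (z j)]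

lemma ee_max (x z : ZMod f → ℤ) (j : ZMod f) (hx : 0 ≤ ee p x j) (hz : 0 ≤ ee p z j) :
    0 ≤ ee p (fun j => max (x j) (z j)) j := by
  unfold ee at *
  have hp0 : (0 : ℤ) ≤ p := by positivity
  have h1 := mul_le_mul_of_nonneg_left (le_max_left (x (j+1)) (z (j+1))) hp0
  have h2 := mul_le_mul_of_nonneg_left (le_max_right (x (j+1)) (z (j+1))) hp0
  simp only
  rcases le_total (x j) (z j) with h3 | h3
  · rw [max_eq_right h3]; linarith
  · rw [max_eq_left h3]; linarith

lemma Feas.min {d : ℕ} {x z : ℕ → ZMod f → ℤ} (hx : Feas p d x) (hz : Feas p d z) :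
    Feas p d (fun r j => min (x r j) (z r j)) where
  zero := by ext j; simp [hx.zero, hz.zero]
  step := fun r hr i => by have := hx.step r hr i; have := hz.step r hr i; omega
  nonneg := fun r hr i => ee_min _ _ _ (hx.nonneg r hr i) (hz.nonneg r hr i)

lemma Feas.max {d : ℕ} {x z : ℕ → ZMod f → ℤ} (hx : Feas p d x) (hz : Feas p d z) :
    Feas p d (fun r j => max (x r j) (z r j)) where
  zero := by ext j; simp [hx.zero, hz.zero]
  step := fun r hr i => by have := hx.step r hr i; have := hz.step r hr i; omega
  nonneg := fun r hr i => ee_max _ _ _ (hx.nonneg r hr i) (hz.nonneg r hr i)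

lemma cost_submod (hG : Good p pos) {d : ℕ} {x z : ℕ → ZMod f → ℤ} (hx : Feas p d x) (hz : Feas p d z) :
    cost p d pos (fun r j => min (x r j) (z r j)) + cost p d pos (fun r j => max (x r j) (z r j)) ≤
      cost p d pos x + cost p d pos z := by
  unfold cost
  rw [← Finset.sum_add_distrib, ← Finset.sum_add_distrib]
  apply Finset.sum_le_sum
  intro r hr
  rw [Finset.mem_range] at hr
  exact FF_submod hG _ _ (hx.nonneg r (by omega)) (hz.nonneg r (by omega))

/-- minimizers -/
def IsMin (p d : ℕ) (pos : ZMod f → ℕ → ℕ) (x : ℕ → ZMod f → ℤ) : Prop :=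
  Feas p d x ∧ ∀ y, Feas p d y → cost p d pos x ≤ cost p d pos y

lemma exists_isMin (hp : 2 ≤ p) (d : ℕ) : ∃ x, IsMin p d pos x := by
  obtain ⟨x, h1, hmin⟩ := (measure fun y => (cost p d pos y).toNat).wf.has_min
    {y | Feas p d y} ⟨fun r _ => r, by
      refine ⟨by ext; simp, fun r _ i => by simp, fun r _ i => ?_⟩
      unfold ee
      have : (1:ℤ) ≤ p := by exact_mod_cast (by omega : 1 ≤ p)
      nlinarith [Int.natCast_nonneg r]⟩
  refine ⟨x, h1, fun y hy => ?_⟩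
  have h2 := hmin y hy
  have h3 : ¬ ((cost p d pos y).toNat < (cost p d pos x).toNat) := h2
  have := cost_nonneg (p := p) (pos := pos) d y
  have := cost_nonneg (p := p) (pos := pos) d x
  omega

lemma isMin_min (hG : Good p pos) {d : ℕ} {x z : ℕ → ZMod f → ℤ} (hx : IsMin p d pos x) (hz : IsMin p d pos z) :
    IsMin p d pos (fun r j => min (x r j) (z r j)) := by
  refine ⟨hx.1.min hz.1, fun y hy => ?_⟩
  have h1 := cost_submod hG hx.1 hz.1
  have h2 := hz.2 _ (hx.1.max hz.1)
  have h3 := hx.2 y hy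
  linarith

end comb
end PS

namespace PS
set_option linter.unusedSectionVars false
section comb
variable {f : ℕ} [NeZero f] {p : ℕ} {pos : ZMod f → ℕ → ℕ}

lemma ee_le_of_eq {x y : ZMod f → ℤ} (h : ∀ j, x j ≤ y j) {j : ZMod f} (hj : x j = y j) : ee p x j ≤ ee p y j := by
  unfold ee
  have hp0 : (0 : ℤ) ≤ p := by positivity
  have := mul_le_mul_of_nonneg_left (h (j + 1)) hp0
  linarith

lemma ee_le_pred (x y : ZMod f → ℤ) {j : ZMod f} (h : x (j + 1) ≤ y (j + 1) - 1) (hj : x j = y j - 1) :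
    ee p x j ≤ ee p y j - (p - 1) := by
  unfold ee
  have hp0 : (0 : ℤ) ≤ p := by positivity
  have := mul_le_mul_of_nonneg_left h hp0
  linarith

def bb (p f J0 t : ℕ) : ℚ := (p : ℚ) ^ (J0 + 1) / (((p : ℚ) ^ f) ^ t * ((p : ℚ) ^ f - 1))

lemma q_gt (hp : 2 ≤ p) : (1 : ℚ) < (p : ℚ) ^ f := by
  have : (1 : ℚ) < p := by exact_mod_cast (by omega : 1 < p)
  exact one_lt_pow₀ this (NeZero.ne f)

lemma bb_step (hp : 2 ≤ p) (J0 t : ℕ) :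
    bb p f J0 t = (p : ℚ) ^ (J0 + 1) / ((p : ℚ) ^ f) ^ (t + 1) + bb p f J0 (t + 1) := by
  have h := q_gt (f := f) hp
  unfold bb
  have h1 : (p : ℚ) ^ f ≠ 0 := by positivity
  have h2 : (p : ℚ) ^ f - 1 ≠ 0 := by linarith
  generalize (p : ℚ) ^ f = q at *
  field_simp
  ring

lemma low (hG : Good p pos) (J0 : ℕ) (x z : ℕ → ZMod f → ℤ) (n : ℕ) : ∀ (t : ℕ) (A' : ZMod f → ℤ),
    (∀ r < n, ∀ i, z r i + 1 ≤ z (r + 1) i) → (∀ r < n, ∀ i, x r i + 1 ≤ x (r + 1) i) →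
    (∀ r < n, ∀ i, x r i ≤ z r i) → (∀ r < n, ∀ i, 0 ≤ ee p (x r) i) →
    (∀ i, x n i ≤ A' i) → (∀ i, A' i ≤ z n i) →
    (∀ j, A' j = z n j ∨ ∀ ρ < (ee p A' j).toNat, pos j ρ + t * f ≤ J0) →
    ∃ z' : ℕ → ZMod f → ℤ, z' n = A' ∧ (∀ r < n, ∀ i, z' r i + 1 ≤ z' (r + 1) i) ∧
      (∀ r ≤ n, ∀ i, x r i ≤ z' r i ∧ z' r i ≤ z r i) ∧ (∀ r < n, ∀ i, 0 ≤ ee p (z' r) i) ∧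
      ((∑ r ∈ Finset.range n, FF p pos (z' r) : ℤ) : ℚ) < ((∑ r ∈ Finset.range n, FF p pos (z r) : ℤ) : ℚ) + bb p f J0 t := by
  have hp := hG.hp
  have hq := q_gt (f := f) hp
  induction n with
  | zero =>
    intro t A' _ _ _ _ h5 h6 _
    refine ⟨fun _ => A', rfl, by simp, fun r hr i => ?_, by simp, ?_⟩
    · obtain rfl : r = 0 := by omega
      exact ⟨h5 i, h6 i⟩
    · simp only [Finset.range_zero, Finset.sum_empty, Int.cast_zero, zero_add]
      unfold bb
      have : (0:ℚ) < (p : ℚ) ^ f - 1 := by linarith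
      positivity
  | succ n ih =>
    intro t A' hz hx hxz hex hxA hAz hinv
    obtain ⟨c, hc1, hc2, hc3, hc4⟩ := maxL hp (x n) (fun j => min (z n j) (A' j - 1))
      (fun j => by have := hx n (by omega) j; have := hxA j; have := hxz n (by omega) j; omega) (hex n (by omega))
    have hcz : ∀ j, c j ≤ z n j := fun j => (hc2 j).trans (min_le_left _ _)
    have hcA : ∀ j, c j ≤ A' j - 1 := fun j => (hc2 j).trans (min_le_right _ _)
    have hinv' : ∀ j, c j = z n j ∨ ∀ ρ < (ee p c j).toNat, pos j ρ + (t + 1) * f ≤ J0 := by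
      intro j
      rcases hc4 j with h | h
      · by_cases h' : c j = z n j
        · exact Or.inl h'
        · right
          intro ρ hρ
          have h1 : c j = A' j - 1 := by omega
          have h2 : A' j ≠ z (n + 1) j := by have := hz n (by omega) j; have := hcz j; omega
          have h3 := ee_le_pred (p := p) c A' (hcA (j + 1)) h1
          have h4 := (hinv j).resolve_left h2 (ρ + (p - 1)) (by omega)
          have h5 := hG.gap j ρ
          have : (t + 1) * f = t * f + f := by ring
          omega
      · right; intro ρ hρ; rw [h] at hρ; simp at hρ
    obtain ⟨z', h1, h2, h3, h4, h5⟩ := ih (t + 1) c (fun r hr => hz r (by omega)) (fun r hr => hx r (by omega))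
      (fun r hr => hxz r (by omega)) (fun r hr => hex r (by omega)) hc1 hcz hinv'
    have hloss : ((FF p pos c : ℤ) : ℚ) < (FF p pos (z n) : ℤ) + (p : ℚ) ^ (J0 + 1) / ((p : ℚ) ^ f) ^ (t + 1) := by
      let U : ZMod f → ℕ := fun j => if c j = z n j then 0 else (ee p c j).toNat
      have hs := sumS hG ((t + 1) * f) J0 U (by
        intro j ρ hρ
        simp only [U] at hρ
        split_ifs at hρ with h
        · omega
        · exact (hinv' j).resolve_left h ρ hρ)
      have hF : FF p pos c ≤ FF p pos (z n) + ∑ j, ∑ ρ ∈ Finset.range (U j), (p : ℤ) ^ (pos j ρ) := by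
        unfold FF
        rw [← Finset.sum_add_distrib]
        apply Finset.sum_le_sum
        intro j _
        simp only [U]
        split_ifs with h
        · simp only [Finset.range_zero, Finset.sum_empty, add_zero]
          exact gg_mono j (ee_le_of_eq hcz h)
        · have := gg_nonneg (p := p) (pos := pos) j (ee p (z n) j)
          change gg p pos j (ee p c j) ≤ _ + gg p pos j (ee p c j)
          linarith
      set S := ∑ j, ∑ ρ ∈ Finset.range (U j), (p : ℤ) ^ (pos j ρ) with hS
      have hs' : (S : ℚ) * ((p : ℚ) ^ f) ^ (t + 1) < (p : ℚ) ^ (J0 + 1) := by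
        rw [← pow_mul, mul_comm f]; exact_mod_cast hs
      have hF' : ((FF p pos c : ℤ) : ℚ) ≤ (FF p pos (z n) : ℤ) + (S : ℚ) := by exact_mod_cast hF
      have : (S : ℚ) < (p : ℚ) ^ (J0 + 1) / ((p : ℚ) ^ f) ^ (t + 1) := by
        rw [lt_div_iff₀ (by positivity)]; exact hs'
      linarith
    refine ⟨fun r => if r ≤ n then z' r else A', by simp, ?_, ?_, ?_, ?_⟩
    · intro r hr i
      rcases Nat.lt_succ_iff_lt_or_eq.mp hr with h | h
      · simp only [show r ≤ n by omega, show r + 1 ≤ n by omega, if_true]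
        exact h2 r h i
      · subst h
        simp only [le_refl, if_true, show ¬ (r + 1 ≤ r) by omega, if_false, h1]
        linarith [hcA i]
    · intro r hr i
      by_cases h : r ≤ n
      · simp only [h, if_true]; exact h3 r h i
      · obtain rfl : r = n + 1 := by omega
        simp only [h, if_false]; exact ⟨hxA i, hAz i⟩
    · intro r hr i
      simp only [show r ≤ n by omega, if_true]
      rcases Nat.lt_succ_iff_lt_or_eq.mp hr with h | h
      · exact h4 r h i
      · subst h; rw [h1]; exact hc3 i
    · rw [Finset.sum_range_succ, Finset.sum_range_succ]
      have : ∑ r ∈ Finset.range n, FF p pos (if r ≤ n then z' r else A') = ∑ r ∈ Finset.range n, FF p pos (z' r) := by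
        apply Finset.sum_congr rfl
        intro r hr
        rw [Finset.mem_range] at hr
        rw [if_pos (by omega)]
      simp only
      rw [this, if_pos le_rfl, h1, bb_step hp]
      push_cast at h5 ⊢
      linarith

/-- Replacing level `n` of the chain `z` by `A'` and repairing below. -/
lemma low_improve (hG : Good p pos) {d : ℕ} {x z : ℕ → ZMod f → ℤ} (hx : Feas p d x) (hz : IsMin p d pos z)
    (hxz : ∀ r ≤ d, ∀ i, x r i ≤ z r i) (n : ℕ) (hn : n ≤ d) (hn0 : 0 < n) (A' : ZMod f → ℤ) (J0 : ℕ)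
    (hxA : ∀ i, x n i ≤ A' i) (hAz : ∀ i, A' i ≤ z n i) (hA : ∀ i, 0 ≤ ee p A' i)
    (hinv : ∀ j, A' j = z n j ∨ ∀ ρ < (ee p A' j).toNat, pos j ρ + 1 * f ≤ J0) :
    (FF p pos (z n) : ℚ) < FF p pos A' + bb p f J0 1 := by
  obtain ⟨z', h1, h2, h3, h4, h5⟩ := low hG J0 x z n 1 A' (fun r hr => hz.1.step r (by omega))
    (fun r hr => hx.step r (by omega)) (fun r hr => hxz r (by omega)) (fun r hr => hx.nonneg r (by omega))
    hxA hAz hinv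
  let y : ℕ → ZMod f → ℤ := fun r => if r ≤ n then z' r else z r
  have hy : Feas p d y := by
    refine ⟨?_, ?_, ?_⟩
    · ext i
      have := h3 0 (by omega) i
      simp only [hx.zero, hz.1.zero, Pi.zero_apply] at this
      simp only [y, Nat.zero_le, if_true, Pi.zero_apply]; omega
    · intro r hr i
      simp only [y]
      by_cases h : r + 1 ≤ n
      · rw [if_pos h, if_pos (by omega)]; exact h2 r (by omega) i
      · by_cases h' : r = n
        · subst h'
          rw [if_neg h, if_pos le_rfl]
          linarith [(h3 r le_rfl i).2, hz.1.step r hr i]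
        · rw [if_neg h, if_neg (by omega)]; exact hz.1.step r hr i
    · intro r hr i
      simp only [y]
      by_cases h : r ≤ n
      · rw [if_pos h]
        by_cases h' : r = n
        · subst h'; rw [h1]; exact hA i
        · exact h4 r (by omega) i
      · rw [if_neg h]; exact hz.1.nonneg r hr i
  have hc := hz.2 y hy
  have hsplit : ∀ w : ℕ → ZMod f → ℤ, cost p d pos w = ∑ r ∈ Finset.range n, FF p pos (w r) + FF p pos (w n) +
      ∑ r ∈ Finset.Ico (n + 1) (d + 1), FF p pos (w r) := by
    intro w
    unfold cost
    rw [← Finset.sum_range_succ, Finset.sum_range_add_sum_Ico _ (by omega)]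
  rw [hsplit, hsplit] at hc
  have e1 : ∑ r ∈ Finset.range n, FF p pos (y r) = ∑ r ∈ Finset.range n, FF p pos (z' r) := by
    apply Finset.sum_congr rfl; intro r hr; rw [Finset.mem_range] at hr; simp only [y]; rw [if_pos (by omega)]
  have e2 : y n = A' := by simp [y, h1]
  have e3 : ∑ r ∈ Finset.Ico (n + 1) (d + 1), FF p pos (y r) = ∑ r ∈ Finset.Ico (n + 1) (d + 1), FF p pos (z r) := by
    apply Finset.sum_congr rfl; intro r hr; rw [Finset.mem_Ico] at hr; simp only [y]; rw [if_neg (by omega)]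
  rw [e1, e2, e3] at hc
  have hc' : ∑ r ∈ Finset.range n, FF p pos (z r) + FF p pos (z n) ≤
    ∑ r ∈ Finset.range n, FF p pos (z' r) + FF p pos A' := by linarith
  have hc'' : ((∑ r ∈ Finset.range n, FF p pos (z r) : ℤ) : ℚ) + (FF p pos (z n) : ℚ) ≤
    ((∑ r ∈ Finset.range n, FF p pos (z' r) : ℤ) : ℚ) + (FF p pos A' : ℚ) := by exact_mod_cast hc'
  linarith

end comb
end PS

namespace PS
set_option linter.unusedSectionVars false
section comb
variable {f : ℕ} [NeZero f] {p : ℕ} {pos : ZMod f → ℕ → ℕ}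

lemma sum_ee (x : ZMod f → ℤ) : ∑ i, ee p x i = ((p : ℤ) - 1) * ∑ i, x i := by
  unfold ee
  rw [Finset.sum_sub_distrib, ← Finset.mul_sum]
  have : ∑ i, x (i + 1) = ∑ i, x i := Equiv.sum_comp (Equiv.addRight (1 : ZMod f)) x
  rw [this]; ring

lemma Feas.ge {d : ℕ} {x : ℕ → ZMod f → ℤ} (hx : Feas p d x) : ∀ r ≤ d, ∀ i, (r : ℤ) ≤ x r i := by
  intro r
  induction r with
  | zero => intro _ i; simp [hx.zero]
  | succ r ih => intro hr i; have := hx.step r (by omega) i; have := ih (by omega) i; push_cast; linarith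

lemma cyc (l j : ZMod f) : j = l + (((j - l).val : ℕ) : ZMod f) := by
  rw [ZMod.natCast_zmod_val]; ring

lemma case2 (hG : Good p pos) {d : ℕ} {x z : ℕ → ZMod f → ℤ} (hx : IsMin p d pos x) (hz : IsMin p d pos z)
    (hxz : ∀ r ≤ d, ∀ i, x r i ≤ z r i) (n : ℕ) (hn : n ≤ d) (hn0 : 0 < n) (hne : x n ≠ z n)
    (hc : ∀ j, ee p (x n) j ≤ ee p (z n) j) : False := by
  classical
  have hp := hG.hp
  have hp1 : (1 : ℤ) < p := by exact_mod_cast (by omega : 1 < p)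
  set a := z n with ha
  obtain ⟨j0, hj0⟩ : ∃ j0, x n j0 < a j0 := by
    by_contra h
    push Not at h
    exact hne (funext fun i => le_antisymm (hxz n hn i) (h i))
  have hstep : ∀ m : ℕ, x n (j0 + m) < a (j0 + m) := by
    intro m
    induction m with
    | zero => simpa using hj0
    | succ m ih =>
      have h1 := hc (j0 + m)
      unfold ee at h1
      push_cast
      rw [← add_assoc]
      by_contra hcon
      push Not at hcon
      have := mul_le_mul_of_nonneg_left hcon (by linarith : (0:ℤ) ≤ p)
      linarith
  have hlt : ∀ j, x n j < a j := fun j => by rw [cyc j0 j]; exact hstep _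
  have hua : ∀ j, 0 ≤ ee p a j := hz.1.nonneg n hn
  obtain ⟨l0, hl0⟩ : ∃ l, 0 < ee p a l := by
    by_contra h
    push Not at h
    have h1 : ∑ i, ee p a i ≤ 0 := Finset.sum_nonpos fun i _ => h i
    rw [sum_ee] at h1
    have h2 : 0 < ∑ i, a i := Finset.sum_pos (fun i _ => by
      have := hz.1.ge n hn i; have : (0:ℤ) < n := by exact_mod_cast hn0
      linarith) Finset.univ_nonempty
    nlinarith
  obtain ⟨l, hl, hmax⟩ := Finset.exists_max_image (Finset.univ.filter fun l => 0 < ee p a l)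
    (fun l => pos l ((ee p a l).toNat - 1)) ⟨l0, by simp [hl0]⟩
  simp only [Finset.mem_filter, Finset.mem_univ, true_and] at hl hmax
  set J := pos l ((ee p a l).toNat - 1) with hJ
  obtain ⟨a', h1, h2, h3, h4⟩ := maxL hp (x n) (fun j => a j - 1) (fun j => by have := hlt j; omega)
    (hx.1.nonneg n hn)
  have hu : ∀ j, ee p a' j = 0 ∨ ee p a' j ≤ ee p a j - (p - 1) := by
    intro j
    rcases h4 j with h | h
    · right; exact ee_le_pred a' a (h2 (j + 1)) h
    · left; exact h
  have key := low_improve hG hx.1 hz hxz n hn hn0 a' J h1 (fun i => (h2 i).trans (sub_le_self _ zero_le_one)) h3 (by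
    intro j
    right
    intro ρ hρ
    rcases hu j with h | h
    · rw [h] at hρ; simp at hρ
    · have h5 := hG.gap j ρ
      have h6 := hmax j (by omega)
      have h7 := hG.mono j (show ρ + (p - 1) ≤ (ee p a j).toNat - 1 by omega)
      omega)
  have hF : FF p pos a' ≤ FF p pos a - (p : ℤ) ^ J := by
    have : ∀ j, gg p pos j (ee p a' j) ≤ gg p pos j (ee p a j) - if j = l then (p : ℤ) ^ J else 0 := by
      intro j
      split_ifs with h
      · subst h
        have h5 : gg p pos j (ee p a' j) ≤ gg p pos j (ee p a j - 1) := gg_mono j (by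
          rcases hu j with h | h <;> omega)
        have h6 := gg_succ (p := p) (pos := pos) j (u := ee p a j - 1) (by omega)
        rw [sub_add_cancel, show (ee p a j - 1).toNat = (ee p a j).toNat - 1 by omega] at h6
        linarith
      · rw [sub_zero]
        apply gg_mono
        have := hua j
        rcases hu j with h | h <;> omega
    have h5 := Finset.sum_le_sum fun j (_ : j ∈ Finset.univ) => this j
    rw [Finset.sum_sub_distrib, Finset.sum_ite_eq' Finset.univ l] at h5
    simpa [FF] using h5
  have hq := q_gt (f := f) hp
  have hb : bb p f J 1 ≤ (p : ℚ) ^ J := by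
    unfold bb
    have h0 : (0:ℚ) < (p : ℚ) ^ f - 1 := by linarith
    rw [div_le_iff₀ (by positivity), pow_succ]
    apply mul_le_mul_of_nonneg_left _ (by positivity)
    have hpq : (p : ℚ) ≤ (p : ℚ) ^ f := le_self_pow₀ (by exact_mod_cast (by omega : 1 ≤ p)) (NeZero.ne f)
    have hqn : (2 : ℚ) ≤ (p : ℚ) ^ f := le_trans (by exact_mod_cast hp) hpq
    rw [pow_one]
    nlinarith
  have hF' : (FF p pos a' : ℚ) ≤ FF p pos a - (p : ℚ) ^ J := by exact_mod_cast hF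
  linarith

lemma case1 (hG : Good p pos) {d : ℕ} {x z : ℕ → ZMod f → ℤ} (hx : IsMin p d pos x) (hz : IsMin p d pos z)
    (hxz : ∀ r ≤ d, ∀ i, x r i ≤ z r i) (n : ℕ) (hn : n ≤ d) (hn0 : 0 < n)
    (hFF : FF p pos (x n) ≤ FF p pos (z n))
    (i0 : ZMod f) (hi0 : ee p (z n) i0 < ee p (x n) i0) : False := by
  classical
  have hp := hG.hp
  have hp1 : (1 : ℤ) < p := by exact_mod_cast (by omega : 1 < p)
  have hp1' : (1 : ℤ) ≤ p := hp1.le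
  set a := z n with ha
  set b := x n with hb
  have hua : ∀ j, 0 ≤ ee p a j := hz.1.nonneg n hn
  have hub : ∀ j, 0 ≤ ee p b j := hx.1.nonneg n hn
  have hba : ∀ j, b j ≤ a j := hxz n hn
  have claim : ∀ i, ee p a i < ee p b i → ∃ l, ee p b l < ee p a l ∧
      pos i (ee p a i).toNat < pos l ((ee p a l).toNat - 1) := by
    intro i hi
    by_contra hcon
    push Not at hcon
    let U : ZMod f → ℕ := fun l => if ee p b l < ee p a l then (ee p a l).toNat else 0
    have hs := sumS_aux hG (pos i (ee p a i).toNat) U (by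
      intro l ρ hρ
      simp only [U] at hρ
      split_ifs at hρ with h
      · have h1 := hcon l h
        have h2 := hG.mono l (show ρ ≤ (ee p a l).toNat - 1 by omega)
        have h3 : pos l ρ ≠ pos i (ee p a i).toNat := by
          intro h'
          have h4 := hG.cls l ρ
          rw [h', hG.cls i] at h4
          subst h4
          omega
        omega
      · omega)
    have : ∀ l, gg p pos l (ee p a l) + (if l = i then (p : ℤ) ^ (pos i (ee p a i).toNat) else 0) ≤
        gg p pos l (ee p b l) + ∑ ρ ∈ Finset.range (U l), (p : ℤ) ^ (pos l ρ) := by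
      intro l
      by_cases hl : l = i
      · subst hl
        have h1 : U l = 0 := by simp only [U]; rw [if_neg (by omega)]
        rw [if_pos rfl, h1, Finset.range_zero, Finset.sum_empty, add_zero, ← gg_succ l (hua l)]
        exact gg_mono l (by omega)
      · rw [if_neg hl, add_zero]
        by_cases h : ee p b l < ee p a l
        · have h1 : U l = (ee p a l).toNat := by simp only [U]; rw [if_pos h]
          rw [h1]
          have := gg_nonneg (p := p) (pos := pos) l (ee p b l)
          change gg p pos l (ee p a l) ≤ _ + gg p pos l (ee p a l)
          linarith
        · have h1 : U l = 0 := by simp only [U]; rw [if_neg h]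
          rw [h1, Finset.range_zero, Finset.sum_empty, add_zero]
          exact gg_mono l (by omega)
    have h5 := Finset.sum_le_sum fun j (_ : j ∈ Finset.univ) => this j
    rw [Finset.sum_add_distrib, Finset.sum_add_distrib, Finset.sum_ite_eq' Finset.univ i] at h5
    simp only [Finset.mem_univ, if_true] at h5
    unfold FF at hFF
    linarith
  obtain ⟨l0, hl0, -⟩ := claim i0 hi0
  obtain ⟨l, hl, hmax⟩ := Finset.exists_max_image (Finset.univ.filter fun l => ee p b l < ee p a l)
    (fun l => pos l ((ee p a l).toNat - 1)) ⟨l0, by simp [hl0]⟩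
  simp only [Finset.mem_filter, Finset.mem_univ, true_and] at hl hmax
  have hbeat : ∀ i, ee p a i < ee p b i → pos i (ee p a i).toNat < pos l ((ee p a l).toNat - 1) := by
    intro i hi
    obtain ⟨l', h1, h2⟩ := claim i hi
    exact lt_of_lt_of_le h2 (hmax l' h1)
  have hex0 : ∃ m : ℕ, 1 ≤ m ∧ ee p a (l + m) < ee p b (l + m) := by
    refine ⟨(i0 - l).val, ?_, by rw [← cyc l i0]; exact hi0⟩
    by_contra h
    have h1 : (i0 - l).val = 0 := by omega
    have h2 := cyc l i0
    rw [h1] at h2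
    simp only [Nat.cast_zero, add_zero] at h2
    subst h2; omega
  obtain ⟨hn01, hn02⟩ := Nat.find_spec hex0
  have hn0min := fun m => Nat.find_min hex0 (m := m)
  set n0 := Nat.find hex0 with hn0def
  have hzeta : ∀ m : ℕ, m + 1 ≤ n0 → b (l + (m + 1 : ℕ)) + 1 ≤ a (l + (m + 1 : ℕ)) := by
    intro m
    induction m with
    | zero =>
      intro _
      have h1 := hl
      unfold ee at h1
      have h2 := hba l
      have h3 := hba (l + 1)
      simp only [zero_add, Nat.cast_one]
      by_contra hcon
      have h4 : a (l + 1) = b (l + 1) := by omega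
      rw [h4] at h1
      linarith
    | succ m ih =>
      intro hm
      have h0 := ih (by omega)
      have h1 : ee p b (l + (m + 1 : ℕ)) ≤ ee p a (l + (m + 1 : ℕ)) := by
        by_contra h
        exact hn0min (m + 1) (by omega) ⟨by omega, by omega⟩
      unfold ee at h1
      have h3 := hba (l + (m + 1 + 1 : ℕ))
      rw [show l + ((m + 1 : ℕ) : ZMod f) + 1 = l + ((m + 1 + 1 : ℕ) : ZMod f) by push_cast; ring] at h1
      by_contra hcon
      have h4 : a (l + (m + 1 + 1 : ℕ)) = b (l + (m + 1 + 1 : ℕ)) := by omega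
      rw [h4] at h1
      linarith
  set i := l + (n0 : ZMod f) with hi
  set J := pos i (ee p a i).toNat with hJ
  have hex1 : ∃ m : ℕ, 1 ≤ m ∧ ∃ ρ < (ee p a (i - m)).toNat, J < pos (i - m) ρ := by
    refine ⟨n0, hn01, ?_⟩
    rw [hi, add_sub_cancel_right]
    exact ⟨(ee p a l).toNat - 1, by have := hub l; omega, hbeat i hn02⟩
  have hn10 : Nat.find hex1 ≤ n0 := Nat.find_min' hex1 (by
    refine ⟨hn01, ?_⟩
    rw [hi, add_sub_cancel_right]
    exact ⟨(ee p a l).toNat - 1, by have := hub l; omega, hbeat i hn02⟩)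
  obtain ⟨hn11, ρm, hρm1, hρm2⟩ := Nat.find_spec hex1
  have hn1min := fun m => Nat.find_min hex1 (m := m)
  set n1 := Nat.find hex1 with hn1def
  set m := i - (n1 : ZMod f) with hm
  have hn1' : ∀ k : ℕ, 1 ≤ k → k < n1 → ∀ ρ < (ee p a (i - k)).toNat, pos (i - k) ρ ≤ J := by
    intro k hk1 hk2 ρ hρ
    by_contra h
    exact hn1min k hk2 ⟨hk1, ρ, hρ, by omega⟩
  let S : Set (ZMod f) := {j | ∃ k < n1, j = i - (k : ZMod f)}
  have hmi : m ≠ i := by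
    intro h
    rw [h] at hρm1 hρm2
    have := hG.mono i hρm1.le
    omega
  have hmS : m ∉ S := by
    rintro ⟨k, hk, hk2⟩
    by_cases h0 : k = 0
    · subst h0; simp at hk2; exact hmi hk2
    · have := hn1' k (by omega) hk ρm (by rw [← hk2]; exact hρm1)
      rw [← hk2] at this
      omega
  have hxS : ∀ j ∈ S, b j + 1 ≤ a j := by
    rintro j ⟨k, hk, rfl⟩
    have h1 := hzeta (n0 - k - 1) (by omega)
    have h2 : l + ((n0 - k - 1 + 1 : ℕ) : ZMod f) = i - k := by
      rw [show n0 - k - 1 + 1 = n0 - k by omega, Nat.cast_sub (by omega), hi]; ring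
    rw [h2] at h1
    exact h1
  obtain ⟨a', h1, h2, h3, h4⟩ := maxL hp b (fun j => a j - if j ∈ S then 1 else 0) (fun j => by
    split_ifs with h
    · linarith [hxS j h]
    · linarith [hba j]) hub
  have h2' : ∀ j, a' j ≤ a j := fun j => (h2 j).trans (by split_ifs <;> linarith)
  have h2S : ∀ j ∈ S, a' j ≤ a j - 1 := fun j hj => by have := h2 j; simp only [if_pos hj] at this; exact this
  -- bound on class `i`
  have hui : ee p a' i ≤ ee p a i + 1 := by
    rcases h4 i with h | h
    · have hmem : i ∈ S := ⟨0, by omega, by simp⟩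
      simp only [if_pos hmem] at h
      have := mul_le_mul_of_nonneg_left (h2' (i + 1)) (by linarith : (0:ℤ) ≤ p)
      unfold ee; linarith
    · have := hua i; omega
  have huo : ∀ j, j ≠ i → ee p a' j ≤ ee p a j := by
    intro j hj
    rcases h4 j with h | h
    · by_cases hS : j ∈ S
      · simp only [if_pos hS] at h
        obtain ⟨k, hk, rfl⟩ := hS
        have hk0 : k ≠ 0 := by rintro rfl; simp at hj
        have hS' : i - (k : ZMod f) + 1 ∈ S := ⟨k - 1, by omega, by
          rw [Nat.cast_sub (by omega)]; push_cast; ring⟩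
        have := ee_le_pred (p := p) a' a (h2S _ hS') h
        linarith
      · simp only [if_neg hS, sub_zero] at h
        exact ee_le_of_eq h2' h
    · have := hua j; omega
  have hum : ee p a' m ≤ ee p a m - 1 := by
    have h5 : 1 ≤ ee p a m := by omega
    rcases h4 m with h | h
    · simp only [if_neg hmS, sub_zero] at h
      have hS' : m + 1 ∈ S := ⟨n1 - 1, by omega, by
          rw [Nat.cast_sub (by omega), hm]; push_cast; ring⟩
      have := mul_le_mul_of_nonneg_left (h2S _ hS') (by linarith : (0:ℤ) ≤ p)
      unfold ee; linarith
    · omega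
  have key := low_improve hG hx.1 hz hxz n hn hn0 a' (J + f) h1 h2' h3 (by
    intro j
    rcases h4 j with h | h
    · by_cases hS : j ∈ S
      · right
        obtain ⟨k, hk, rfl⟩ := hS
        intro ρ hρ
        by_cases hk0 : k = 0
        · subst hk0
          simp only [Nat.cast_zero, sub_zero] at hρ ⊢
          have := hG.mono i (show ρ ≤ (ee p a i).toNat by omega)
          omega
        · by_cases hki : i - (k : ZMod f) = i
          · rw [hki] at hρ ⊢
            have := hG.mono i (show ρ ≤ (ee p a i).toNat by omega)
            omega
          · have h5 := huo _ hki
            have := hn1' k (by omega) hk ρ (by omega)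
            omega
      · left
        simpa only [if_neg hS, sub_zero] using h
    · right; intro ρ hρ; rw [h] at hρ; simp at hρ)
  have hF : FF p pos a' ≤ FF p pos a + (p : ℤ) ^ J - (p : ℤ) ^ (J + 1) := by
    have : ∀ j, gg p pos j (ee p a' j) ≤ gg p pos j (ee p a j) + (if j = i then (p : ℤ) ^ J else 0)
        - if j = m then (p : ℤ) ^ (J + 1) else 0 := by
      intro j
      by_cases hji : j = i
      · subst hji
        rw [if_pos rfl, if_neg (Ne.symm hmi), sub_zero, ← gg_succ _ (hua _)]
        exact gg_mono _ hui
      · rw [if_neg hji, add_zero]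
        by_cases hjm : j = m
        · rw [if_pos hjm, hjm]
          have h5 : gg p pos m (ee p a' m) ≤ gg p pos m (ee p a m - 1) := gg_mono m hum
          have h6 := gg_succ (p := p) (pos := pos) m (u := ee p a m - 1) (by omega)
          rw [sub_add_cancel] at h6
          have h7 : (p : ℤ) ^ (J + 1) ≤ (p : ℤ) ^ (pos m (ee p a m - 1).toNat) := by
            apply pow_le_pow_right₀ hp1'
            have := hG.mono m (show ρm ≤ (ee p a m - 1).toNat by omega)
            omega
          linarith
        · rw [if_neg hjm, sub_zero]
          exact gg_mono _ (huo _ hji)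
    have h5 := Finset.sum_le_sum fun j (_ : j ∈ Finset.univ) => this j
    rw [Finset.sum_sub_distrib, Finset.sum_add_distrib, Finset.sum_ite_eq' Finset.univ i,
      Finset.sum_ite_eq' Finset.univ m] at h5
    simpa [FF] using h5
  have hf2 : 2 ≤ f := by
    by_contra h
    have h0 := NeZero.ne f
    obtain rfl : f = 1 := by omega
    exact hmi (Subsingleton.elim (α := ZMod 1) _ _)
  have hq := q_gt (f := f) hp
  have hb : bb p f (J + f) 1 ≤ (p : ℚ) ^ (J + 1) - (p : ℚ) ^ J := by
    unfold bb
    have h0 : (0:ℚ) < (p : ℚ) ^ f - 1 := by linarith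
    have hpq : (p : ℚ) ^ 2 ≤ (p : ℚ) ^ f := pow_le_pow_right₀ (by exact_mod_cast (by omega : 1 ≤ p)) hf2
    have hp2 : (2 : ℚ) ≤ p := by exact_mod_cast hp
    rw [div_le_iff₀ (by positivity), pow_one, show J + f + 1 = J + f + 1 from rfl, pow_succ, pow_add, pow_succ]
    generalize (p : ℚ) ^ f = q at *
    have hJ0 : (0 : ℚ) < (p : ℚ) ^ J := by positivity
    generalize (p : ℚ) ^ J = r at *
    have : (p : ℚ) ≤ (p - 1) * (q - 1) := by nlinarith
    have h6 : r * q * p ≤ r * q * ((p - 1) * (q - 1)) := mul_le_mul_of_nonneg_left this (by nlinarith)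
    linarith
  have hF' : (FF p pos a' : ℚ) ≤ FF p pos a + (p : ℚ) ^ J - (p : ℚ) ^ (J + 1) := by exact_mod_cast hF
  linarith

lemma unique_le (hG : Good p pos) {d : ℕ} {x z : ℕ → ZMod f → ℤ} (hx : IsMin p d pos x) (hz : IsMin p d pos z)
    (hxz : ∀ r ≤ d, ∀ i, x r i ≤ z r i) : ∀ r ≤ d, x r = z r := by
  classical
  by_contra hcon
  push Not at hcon
  obtain ⟨r0, hr0, hr0'⟩ := hcon
  obtain ⟨n, hn, hmax⟩ := Finset.exists_max_image ((Finset.range (d + 1)).filter fun r => x r ≠ z r) id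
    ⟨r0, by simp [hr0', Nat.lt_succ_of_le hr0]⟩
  simp only [Finset.mem_filter, Finset.mem_range, id] at hn hmax
  obtain ⟨hn1, hne⟩ := hn
  have hnd : n ≤ d := by omega
  have habove : ∀ r, n < r → r ≤ d → x r = z r := by
    intro r h1 h2
    by_contra h
    have := hmax r ⟨by omega, h⟩
    omega
  have hn0 : 0 < n := by
    rcases Nat.eq_zero_or_pos n with h | h
    · subst h; rw [hx.1.zero, hz.1.zero] at hne; exact absurd rfl hne
    · exact h
  have hFF : FF p pos (x n) ≤ FF p pos (z n) := by
    let y : ℕ → ZMod f → ℤ := Function.update x n (z n)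
    have hyn : y n = z n := by simp [y]
    have hyo : ∀ r, r ≠ n → y r = x r := fun r hr => by simp [y, hr]
    have hy : Feas p d y := by
      refine ⟨by rw [hyo 0 (by omega)]; exact hx.1.zero, fun r hr i => ?_, fun r hr i => ?_⟩
      · by_cases h : r = n
        · subst h; rw [hyn, hyo (r + 1) (by omega), habove (r + 1) (by omega) (by omega)]
          exact hz.1.step r hr i
        · rw [hyo r h]
          by_cases h' : r + 1 = n
          · rw [h', hyn, ← h']
            have := hx.1.step r hr i
            have := hxz (r + 1) (by omega) i
            linarith
          · rw [hyo _ h']; exact hx.1.step r hr i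
      · by_cases h : r = n
        · subst h; rw [hyn]; exact hz.1.nonneg r hr i
        · rw [hyo r h]; exact hx.1.nonneg r hr i
    have h1 := hx.2 y hy
    unfold cost at h1
    rw [← Finset.add_sum_erase _ _ (show n ∈ Finset.range (d + 1) by simp; omega),
      ← Finset.add_sum_erase _ (fun r => FF p pos (y r)) (show n ∈ Finset.range (d + 1) by simp; omega)] at h1
    have h2 : ∑ r ∈ (Finset.range (d + 1)).erase n, FF p pos (y r) =
        ∑ r ∈ (Finset.range (d + 1)).erase n, FF p pos (x r) :=
      Finset.sum_congr rfl fun r hr => by rw [hyo r (Finset.ne_of_mem_erase hr)]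
    rw [h2, hyn] at h1
    linarith
  by_cases hc : ∀ j, ee p (x n) j ≤ ee p (z n) j
  · exact case2 hG hx hz hxz n hnd hn0 hne hc
  · push Not at hc
    obtain ⟨i, hi⟩ := hc
    exact case1 hG hx hz hxz n hnd hn0 hFF i hi

lemma unique_min (hG : Good p pos) {d : ℕ} {x z : ℕ → ZMod f → ℤ} (hx : IsMin p d pos x) (hz : IsMin p d pos z) :
    ∀ r ≤ d, x r = z r := by
  have hm := isMin_min hG hx hz
  have h1 := unique_le hG hm hx (fun r _ i => min_le_left _ _)
  have h2 := unique_le hG hm hz (fun r _ i => min_le_right _ _)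
  intro r hr
  exact (h1 r hr).symm.trans (h2 r hr)

end comb
end PS

namespace PS
set_option linter.unusedSectionVars false
section comb
variable {f : ℕ} [NeZero f] {p : ℕ} {pos : ZMod f → ℕ → ℕ}

lemma nested (hG : Good p pos) {d : ℕ} {x : ℕ → ZMod f → ℤ} (hx : IsMin p d pos x) (r : ℕ) (hr : r < d)
    (i : ZMod f) : ee p (x r) i ≤ ee p (x (r + 1)) i := by
  classical
  by_contra hcon
  push Not at hcon
  have hp := hG.hp
  have hp2 : (2 : ℤ) ≤ p := by exact_mod_cast hp
  have hr1 : r ≠ 0 := by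
    rintro rfl
    have h1 := hx.1.nonneg 1 (by omega) i
    have h2 : ee p (x 0) i = 0 := by rw [hx.1.zero]; simp [ee]
    simp only [zero_add] at hcon
    omega
  set δ : ZMod f → ℤ := fun j => x (r + 1) j - x r j with hδ
  have hee : ∀ j, ee p δ j = ee p (x (r + 1)) j - ee p (x r) j := fun j => ee_sub _ _ j
  have hδ1 : ∀ j, 1 ≤ δ j := fun j => by have := hx.1.step r hr j; simp only [hδ]; omega
  have hδi : 3 ≤ δ i := by
    have h1 := hee i
    unfold ee at h1 hcon
    have h2 := mul_le_mul_of_nonneg_left (hδ1 (i + 1)) (by linarith : (0:ℤ) ≤ p)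
    linarith
  obtain ⟨η, h1, h2, h3, h4⟩ := minL hp (fun j => max (ee p δ j) 0) (fun j => if j = i then 1 else 0)
    (fun j => (δ j - 1) / 2) (by
      intro j
      split_ifs with h
      · subst h; omega
      · have := hδ1 j; omega) (by
      intro j
      apply le_max_iff.mpr
      by_cases h0 : 0 ≤ ee p δ j
      · left
        unfold ee at h0 ⊢
        have a1 : 2 * ((δ (j + 1) - 1) / 2) ≤ δ (j + 1) - 1 := by omega
        have a2 := mul_le_mul_of_nonneg_left a1 (by linarith : (0:ℤ) ≤ p)
        have a3 : δ j - 2 ≤ 2 * ((δ j - 1) / 2) := by omega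
        nlinarith
      · right
        unfold ee at h0 ⊢
        have a1 : 2 * ((δ (j + 1) - 1) / 2) ≤ δ (j + 1) - 1 := by omega
        have a2 := mul_le_mul_of_nonneg_left a1 (by linarith : (0:ℤ) ≤ p)
        have a3 : δ j - 2 ≤ 2 * ((δ j - 1) / 2) := by omega
        nlinarith)
  have hη0 : ∀ j, 0 ≤ η j := fun j => le_trans (by split_ifs <;> norm_num) (h1 j)
  have hηi : 1 ≤ η i := by have := h1 i; simpa using this
  have hbet : ∀ j, (0 ≤ ee p η j ∧ ee p η j ≤ ee p (x (r + 1)) j - ee p (x r) j) ∨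
      (ee p η j ≤ 0 ∧ ee p (x (r + 1)) j - ee p (x r) j ≤ ee p η j) := by
    intro j
    rw [← hee j]
    have h5 := h3 j
    rcases h4 j with h | h
    · have h6 : 0 ≤ (p : ℤ) * η (j + 1) := mul_nonneg (by linarith) (hη0 _)
      have h7 : ee p η j = p * η (j + 1) - η j := rfl
      by_cases hj : j = i
      · rw [if_pos hj] at h
        subst hj
        have h8 := hee j
        right
        constructor
        · omega
        · omega
      · rw [if_neg hj] at h
        omega
    · omega
  let y : ℕ → ZMod f → ℤ := Function.update (Function.update x r (fun j => x r j + η j)) (r + 1)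
    (fun j => x (r + 1) j - η j)
  have hy1 : y (r + 1) = fun j => x (r + 1) j - η j := by simp [y]
  have hy0 : y r = fun j => x r j + η j := by simp [y]
  have hyo : ∀ s, s ≠ r → s ≠ r + 1 → y s = x s := fun s a b => by simp [y, a, b]
  have hyF : Feas p d y := by
    refine ⟨by rw [hyo 0 (by omega) (by omega)]; exact hx.1.zero, fun s hs j => ?_, fun s hs j => ?_⟩
    · have h5 := hx.1.step s hs j
      have h6 := hη0 j
      have h7 := h2 j
      by_cases c1 : s = r
      · subst c1; rw [hy0, hy1]; simp only [hδ] at h7 ⊢; omega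
      · by_cases c2 : s = r + 1
        · subst c2; rw [hy1, hyo (r + 1 + 1) (by omega) (by omega)]; simp only; omega
        · rw [hyo s c1 c2]
          by_cases c3 : s + 1 = r
          · rw [c3, hy0, ← c3]; simp only; omega
          · rw [hyo (s + 1) c3 (by omega)]; exact h5
    · have h5 := hx.1.nonneg r (by omega) j
      have h6 := hx.1.nonneg (r + 1) (by omega) j
      have h7 := hbet j
      by_cases c1 : s = r
      · subst c1; rw [hy0, ee_add]; omega
      · by_cases c2 : s = r + 1
        · subst c2; rw [hy1, ee_sub]; omega
        · rw [hyo s c1 c2]; exact hx.1.nonneg s hs j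
  have hyM : IsMin p d pos y := by
    refine ⟨hyF, fun w hw => le_trans ?_ (hx.2 w hw)⟩
    have hsplit : ∀ w : ℕ → ZMod f → ℤ, cost p d pos w = FF p pos (w r) + (FF p pos (w (r + 1)) +
        ∑ s ∈ ((Finset.range (d + 1)).erase r).erase (r + 1), FF p pos (w s)) := by
      intro w
      unfold cost
      rw [← Finset.add_sum_erase _ _ (show r ∈ Finset.range (d + 1) by simp; omega),
        ← Finset.add_sum_erase _ _ (show r + 1 ∈ (Finset.range (d + 1)).erase r by simp; omega)]
    rw [hsplit, hsplit]
    have e1 : ∑ s ∈ ((Finset.range (d + 1)).erase r).erase (r + 1), FF p pos (y s) =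
        ∑ s ∈ ((Finset.range (d + 1)).erase r).erase (r + 1), FF p pos (x s) := by
      apply Finset.sum_congr rfl
      intro s hs
      simp only [Finset.mem_erase] at hs
      rw [hyo s hs.2.1 hs.1]
    rw [e1]
    have e2 : FF p pos (y r) + FF p pos (y (r + 1)) ≤ FF p pos (x r) + FF p pos (x (r + 1)) := by
      unfold FF
      rw [← Finset.sum_add_distrib, ← Finset.sum_add_distrib]
      apply Finset.sum_le_sum
      intro j _
      rw [hy0, hy1, ee_add, ee_sub]
      exact gg_conv' hG j (hx.1.nonneg r (by omega) j) (hx.1.nonneg (r + 1) (by omega) j) (hbet j)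
    linarith
  have h5 := congrFun (unique_min hG hx hyM r (by omega)) i
  rw [hy0] at h5
  simp only at h5
  omega

lemma tele (x : ZMod f → ℤ) (c : ZMod f) (n : ℕ) :
    ∑ m ∈ Finset.range n, (p : ℤ) ^ m * ee p x (c + m) = (p : ℤ) ^ n * x (c + n) - x c := by
  induction n with
  | zero => simp
  | succ n ih =>
    rw [Finset.sum_range_succ, ih]
    unfold ee
    push_cast
    rw [add_assoc c]; ring

lemma bockle (hp : 2 ≤ p) (Γ : ZMod f → ℤ) (hΓ : ∀ j, 0 ≤ Γ j) (d : ℕ)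
    (h : ∀ c : ZMod f, (d : ℤ) * ((p : ℤ) ^ f - 1) ≤ ∑ m ∈ Finset.range f, (p : ℤ) ^ m * Γ (c + m)) :
    ∃ X : ZMod f → ℤ, (∀ j, (d : ℤ) ≤ X j) ∧ ∀ j, ee p X j ≤ Γ j := by
  classical
  have hp2 : (2 : ℤ) ≤ p := by exact_mod_cast hp
  obtain ⟨X, ⟨h1, h2⟩, hmin⟩ := (measure fun X : ZMod f → ℤ => (∑ j, Γ j - ∑ j, X j).toNat).wf.has_min
    {X | (∀ j, 0 ≤ X j) ∧ ∀ j, ee p X j ≤ Γ j} ⟨0, by simp, fun j => by simpa [ee] using hΓ j⟩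
  have hbd : ∀ X : ZMod f → ℤ, (∀ j, 0 ≤ X j) → (∀ j, ee p X j ≤ Γ j) → ∑ j, X j ≤ ∑ j, Γ j := by
    intro X h1 h2
    have h3 := Finset.sum_le_sum fun j (_ : j ∈ Finset.univ) => h2 j
    rw [sum_ee] at h3
    have h4 : 0 ≤ ∑ j, X j := Finset.sum_nonneg fun j _ => h1 j
    nlinarith
  have hmax : ∀ Y : ZMod f → ℤ, (∀ j, 0 ≤ Y j) → (∀ j, ee p Y j ≤ Γ j) → ∑ j, Y j ≤ ∑ j, X j := by
    intro Y a b
    have h3 : ¬ ((∑ j, Γ j - ∑ j, Y j).toNat < (∑ j, Γ j - ∑ j, X j).toNat) := hmin Y ⟨a, b⟩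
    have := hbd X h1 h2
    have := hbd Y a b
    omega
  have hloc : ∀ i, Γ i ≤ ee p X i + (p - 1) := by
    intro i
    by_contra hcon
    push Not at hcon
    let Y := Function.update X (i + 1) (X (i + 1) + 1)
    have hY : Y (i + 1) = X (i + 1) + 1 := by simp [Y]
    have hYo : ∀ j, j ≠ i + 1 → Y j = X j := fun j hj => by simp [Y, hj]
    have hge : ∀ j, X j ≤ Y j := by
      intro j
      by_cases hj : j = i + 1
      · subst hj; omega
      · rw [hYo j hj]
    have := hmax Y (fun j => (h1 j).trans (hge j)) (by
      intro j
      by_cases hj : j = i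
      · subst hj
        have := hge j
        unfold ee at hcon ⊢
        rw [hY]; linarith
      · have : Y (j + 1) = X (j + 1) := hYo _ (by simpa using hj)
        have h3 := hge j
        have h4 := h2 j
        unfold ee at h4 ⊢
        rw [this]; linarith)
    have h5 : ∑ j, X j < ∑ j, Y j := Finset.sum_lt_sum (fun j _ => hge j) ⟨i + 1, Finset.mem_univ _, by omega⟩
    linarith
  have hstr : ∃ i, Γ i < ee p X i + (p - 1) := by
    by_contra hcon
    push Not at hcon
    have := hmax (fun j => X j + 1) (fun j => by linarith [h1 j]) (fun j => by
      have := hcon j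
      unfold ee at this ⊢
      linarith)
    have h5 : ∑ j, X j < ∑ j, (X j + 1) := Finset.sum_lt_sum_of_nonempty Finset.univ_nonempty (fun j _ => by omega)
    linarith
  refine ⟨X, fun c => ?_, h2⟩
  obtain ⟨i, hi⟩ := hstr
  have hlt : ∑ m ∈ Finset.range f, (p : ℤ) ^ m * Γ (c + m) <
      ∑ m ∈ Finset.range f, (p : ℤ) ^ m * (ee p X (c + m) + (p - 1)) := by
    apply Finset.sum_lt_sum
    · intro m _
      exact mul_le_mul_of_nonneg_left (hloc _) (by positivity)
    · refine ⟨(i - c).val, Finset.mem_range.mpr (ZMod.val_lt _), ?_⟩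
      rw [← cyc c i]
      exact mul_lt_mul_of_pos_left hi (by positivity)
  have htel := tele (p := p) (fun j => X j + 1) c f
  have heq : ∀ j, ee p (fun j => X j + 1) j = ee p X j + (p - 1) := fun j => by unfold ee; ring
  simp only [heq, CharP.cast_eq_zero, add_zero] at htel
  rw [htel] at hlt
  have h6 := h c
  have h7 : (d : ℤ) * ((p : ℤ) ^ f - 1) < (X c + 1) * ((p : ℤ) ^ f - 1) := by linarith
  have h8 : (0 : ℤ) < (p : ℤ) ^ f - 1 := by
    have := one_lt_pow₀ (show (1 : ℤ) < p by linarith) (NeZero.ne f)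
    linarith
  have := lt_of_mul_lt_mul_right h7 h8.le
  omega

lemma chain_of (hp : 2 ≤ p) (Γ : ZMod f → ℤ) (hΓ : ∀ j, 0 ≤ Γ j) (d : ℕ) : ∀ (X : ZMod f → ℤ),
    (∀ j, (d : ℤ) ≤ X j) → (∀ j, ee p X j ≤ Γ j) →
    ∃ y : ℕ → ZMod f → ℤ, Feas p d y ∧ (∀ j, y d j ≤ X j) ∧ ∀ r ≤ d, ∀ j, ee p (y r) j ≤ Γ j := by
  have hp2 : (2 : ℤ) ≤ p := by exact_mod_cast hp
  induction d with
  | zero =>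
    intro X h1 h2
    refine ⟨fun _ => 0, ⟨rfl, by simp, fun r _ i => by simp [ee]⟩, fun j => by simpa using h1 j, fun r _ j => by
      simpa [ee] using hΓ j⟩
  | succ d ih =>
    intro X h1 h2
    obtain ⟨w, w1, w2, w3, w4⟩ := minL hp Γ (fun _ => (d + 1 : ℕ)) X h1 h2
    obtain ⟨y, y1, y2, y3⟩ := ih (fun j => w j - 1) (fun j => by have := w1 j; push_cast at this; linarith) (fun j => by
      have := w3 j
      unfold ee at this ⊢
      linarith)
    have hw0 : ∀ j, 0 ≤ ee p w j := by
      intro j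
      rcases w4 j with h | h
      · have a1 := w1 (j + 1)
        unfold ee
        rw [h]
        nlinarith [Int.natCast_nonneg (d + 1)]
      · rw [h]; exact hΓ j
    refine ⟨fun r => if r ≤ d then y r else w, ⟨by simpa using y1.zero, ?_, ?_⟩, ?_, ?_⟩
    · intro r hr j
      by_cases h : r + 1 ≤ d
      · simp only [h, show r ≤ d by omega, if_true]; exact y1.step r (by omega) j
      · obtain rfl : r = d := by omega
        simp only [h, le_refl, if_true, if_false]
        have := y2 j; linarith
    · intro r hr j
      by_cases h : r ≤ d
      · simp only [h, if_true]; exact y1.nonneg r h j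
      · simp only [h, if_false]; exact hw0 j
    · intro j; simp [w2 j]
    · intro r hr j
      by_cases h : r ≤ d
      · simp only [h, if_true]; exact y3 r h j
      · simp only [h, if_false]; exact w3 j

end comb
end PS

namespace PS
set_option linter.unusedSectionVars false
section units
variable {f : ℕ} [NeZero f] {p : ℕ}

def Gam (L : ℕ) (w : ℕ → ℕ) (e : ZMod f) : ℤ := ∑ j ∈ Finset.range L, if (j : ZMod f) = e then (w j : ℤ) else 0

def YY (p L : ℕ) (w : ℕ → ℕ) (c : ZMod f) : ℤ := ∑ j ∈ Finset.range L, (w j : ℤ) * (p : ℤ) ^ ((j : ZMod f) - c).val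

def nn (p L : ℕ) (w : ℕ → ℕ) : ℕ := ∑ j ∈ Finset.range L, w j * p ^ j

lemma Gam_nonneg (L : ℕ) (w : ℕ → ℕ) (e : ZMod f) : 0 ≤ Gam L w e := by
  unfold Gam; apply Finset.sum_nonneg; intro j _; split_ifs <;> positivity

lemma pow_val_pred (a : ZMod f) :
    (p : ℤ) * (p : ℤ) ^ (a - 1).val = (p : ℤ) ^ a.val + if a = 0 then (p : ℤ) ^ f - 1 else 0 := by
  have hv := ZMod.val_lt (a - 1)
  have ha : a = (((a - 1).val + 1 : ℕ) : ZMod f) := by push_cast; rw [ZMod.natCast_zmod_val]; ring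
  set v := (a - 1).val with hvdef
  rw [← pow_succ']
  by_cases h : v + 1 < f
  · have h1 : a.val = v + 1 := by rw [ha, ZMod.val_natCast, Nat.mod_eq_of_lt h]
    have h2 : a ≠ 0 := by intro h0; rw [h0, ZMod.val_zero] at h1; omega
    rw [h1, if_neg h2, add_zero]
  · have h1 : v + 1 = f := by omega
    have h2 : a = 0 := by rw [ha, h1, ZMod.natCast_self]
    rw [if_pos h2, h2, ZMod.val_zero, h1]; ring

lemma ee_YY (L : ℕ) (w : ℕ → ℕ) (c : ZMod f) : ee p (YY p L w) c = ((p : ℤ) ^ f - 1) * Gam L w c := by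
  unfold ee YY Gam
  rw [Finset.mul_sum, Finset.mul_sum, ← Finset.sum_sub_distrib]
  apply Finset.sum_congr rfl
  intro j _
  have := pow_val_pred (p := p) ((j : ZMod f) - c)
  rw [show (j : ZMod f) - (c + 1) = (j : ZMod f) - c - 1 by ring,
    show (p : ℤ) * ((w j : ℤ) * (p : ℤ) ^ ((j : ZMod f) - c - 1).val) =
      (w j : ℤ) * ((p : ℤ) * (p : ℤ) ^ ((j : ZMod f) - c - 1).val) by ring, this]
  by_cases h : (j : ZMod f) = c
  · rw [if_pos h, if_pos (by rw [h, sub_self])]; ring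
  · rw [if_neg h, if_neg (by rwa [sub_eq_zero])]; ring

lemma q_pos' (hp : 2 ≤ p) : (0 : ℤ) < (p : ℤ) ^ f - 1 := by
  have := one_lt_pow₀ (show (1 : ℤ) < p by exact_mod_cast (by omega : 1 < p)) (NeZero.ne f)
  linarith

lemma YY_zero_mod (L : ℕ) (w : ℕ → ℕ) : ((p : ℤ) ^ f - 1) ∣ (nn p L w : ℤ) - YY p L w (0 : ZMod f) := by
  unfold nn YY
  push_cast
  rw [← Finset.sum_sub_distrib]
  apply Finset.dvd_sum
  intro j _
  rw [← mul_sub, sub_zero, ZMod.val_natCast]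
  apply Dvd.dvd.mul_left
  conv_rhs => rw [← Nat.div_add_mod j f]
  rw [Nat.mul_add_mod_self_left, Nat.mod_mod, pow_add, pow_mul]
  have h1 : ((p : ℤ) ^ f - 1) ∣ ((p : ℤ) ^ f) ^ (j / f) - 1 := sub_one_dvd_pow_sub_one _ _
  have : ((p : ℤ) ^ f) ^ (j / f) * (p : ℤ) ^ (j % f) - (p : ℤ) ^ (j % f) =
    (((p : ℤ) ^ f) ^ (j / f) - 1) * (p : ℤ) ^ (j % f) := by ring
  rw [this]
  exact Dvd.dvd.mul_right h1 _

lemma coprime_p (_hp : 2 ≤ p) : IsCoprime ((p : ℤ) ^ f - 1) (p : ℤ) := by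
  refine ⟨-1, (p : ℤ) ^ (f - 1), ?_⟩
  have : (p : ℤ) ^ f = (p : ℤ) ^ (f - 1) * p := by
    rw [← pow_succ]; congr 1; have := NeZero.ne f; omega
  rw [this]; ring

lemma YY_dvd (hp : 2 ≤ p) (L : ℕ) (w : ℕ → ℕ) (h : ((p : ℤ) ^ f - 1) ∣ (nn p L w : ℤ)) :
    ∃ x : ZMod f → ℤ, (∀ c, ee p x c = Gam L w c) ∧ (∀ c, ((p : ℤ) ^ f - 1) * x c = YY p L w c) ∧
      (0 < nn p L w → ∀ c, 1 ≤ x c) := by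
  have hq := q_pos' (f := f) hp
  have h0 : ((p : ℤ) ^ f - 1) ∣ YY p L w (0 : ZMod f) := by
    have := dvd_sub h (YY_zero_mod (f := f) L w)
    rwa [sub_sub_cancel] at this
  have hn : ∀ n : ℕ, ((p : ℤ) ^ f - 1) ∣ YY p L w (0 + (n : ZMod f)) := by
    intro n
    induction n with
    | zero => simpa using h0
    | succ n ih =>
      have h1 := ee_YY (p := p) L w (0 + (n : ZMod f))
      unfold ee at h1
      have h2 : ((p : ℤ) ^ f - 1) ∣ (p : ℤ) * YY p L w (0 + (n : ZMod f) + 1) := by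
        have : (p : ℤ) * YY p L w (0 + (n : ZMod f) + 1) = YY p L w (0 + (n : ZMod f)) +
          ((p : ℤ) ^ f - 1) * Gam L w (0 + (n : ZMod f)) := by linarith
        rw [this]
        exact dvd_add ih (Dvd.intro _ rfl)
      have h3 := (coprime_p (f := f) hp).dvd_of_dvd_mul_left h2
      push_cast
      rwa [← add_assoc]
  have hall : ∀ c : ZMod f, ((p : ℤ) ^ f - 1) ∣ YY p L w c := fun c => by rw [cyc 0 c]; exact hn _
  choose x hx using hall
  refine ⟨x, fun c => ?_, fun c => (hx c).symm, fun hpos c => ?_⟩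
  · have h1 := ee_YY (p := p) L w c
    have h2 : ee p (YY p L w) c = ((p : ℤ) ^ f - 1) * ee p x c := by
      unfold ee; rw [hx, hx]; ring
    rw [h2] at h1
    exact mul_left_cancel₀ hq.ne' h1
  · have h1 : 0 < YY p L w c := by
      unfold YY
      obtain ⟨j, hj, hj2⟩ : ∃ j ∈ Finset.range L, w j * p ^ j ≠ 0 := by
        by_contra hcon
        push Not at hcon
        exact hpos.ne' (Finset.sum_eq_zero hcon)
      apply Finset.sum_pos' (fun j _ => by positivity) ⟨j, hj, ?_⟩
      have : 0 < w j := Nat.pos_of_ne_zero fun h => hj2 (by rw [h, zero_mul])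
      positivity
    rw [hx c] at h1
    have := pos_of_mul_pos_right h1 hq.le
    omega

lemma YY_of (hp : 2 ≤ p) (L : ℕ) (w : ℕ → ℕ) (x : ZMod f → ℤ) (hx : ∀ c, ee p x c = Gam L w c) (c : ZMod f) :
    ((p : ℤ) ^ f - 1) * x c = YY p L w c := by
  have hq := q_pos' (f := f) hp
  have h1 := tele (p := p) x c f
  have h2 := tele (p := p) (YY p L w) c f
  simp only [ZMod.natCast_self, add_zero] at h1 h2
  simp only [ee_YY, ← hx] at h2
  have h3 : ∑ m ∈ Finset.range f, (p : ℤ) ^ m * (((p : ℤ) ^ f - 1) * ee p x (c + m)) =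
    ((p : ℤ) ^ f - 1) * ∑ m ∈ Finset.range f, (p : ℤ) ^ m * ee p x (c + m) := by
    rw [Finset.mul_sum]; apply Finset.sum_congr rfl; intros; ring
  rw [h3, h1] at h2
  apply mul_left_cancel₀ hq.ne'
  linarith

lemma nn_of (hp : 2 ≤ p) (L : ℕ) (w : ℕ → ℕ) (x : ZMod f → ℤ) (hx : ∀ c, ee p x c = Gam L w c) (hx1 : 1 ≤ x 0) :
    ((p : ℤ) ^ f - 1) ∣ (nn p L w : ℤ) ∧ 0 < nn p L w := by
  have hq := q_pos' (f := f) hp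
  have h0 := YY_of hp L w x hx 0
  constructor
  · have := dvd_add (YY_zero_mod (p := p) (f := f) L w) (Dvd.intro _ h0)
    rwa [sub_add_cancel] at this
  · rcases Nat.eq_zero_or_pos (nn p L w) with h | h
    · exfalso
      have h2 : ∀ j ∈ Finset.range L, w j = 0 := by
        intro j hj
        have := (Finset.sum_eq_zero_iff.mp h) j hj
        have h3 : p ^ j ≠ 0 := by positivity
        exact (Nat.mul_eq_zero.mp this).resolve_right h3
      have h3 : YY p L w (0 : ZMod f) = 0 := by
        unfold YY; apply Finset.sum_eq_zero; intro j hj; rw [h2 j hj]; simp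
      rw [h3] at h0
      nlinarith
    · exact h

lemma tele_Gam (hp : 2 ≤ p) (L : ℕ) (w : ℕ → ℕ) (c : ZMod f) :
    ∑ m ∈ Finset.range f, (p : ℤ) ^ m * Gam L w (c + (m : ZMod f)) = YY p L w c := by
  have hq := q_pos' (f := f) hp
  have h2 := tele (p := p) (YY p L w) c f
  simp only [ZMod.natCast_self, add_zero, ee_YY] at h2
  apply mul_left_cancel₀ hq.ne'
  rw [Finset.mul_sum]
  rw [show ((p : ℤ) ^ f - 1) * YY p L w c = (p : ℤ) ^ f * YY p L w c - YY p L w c by ring, ← h2]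
  apply Finset.sum_congr rfl; intros; ring

/-! digits -/

def dig (p k j : ℕ) : ℕ := k / p ^ j % p

lemma dig_sum (p k N : ℕ) : ∑ j ∈ Finset.range N, dig p k j * p ^ j = k % p ^ N := by
  induction N with
  | zero => simp [Nat.mod_one]
  | succ N ih => rw [Finset.sum_range_succ, ih, Nat.mod_pow_succ, dig]; ring

lemma dig_zero {k N : ℕ} (hp : 2 ≤ p) (h : k < p ^ N) {j : ℕ} (hj : N ≤ j) : dig p k j = 0 := by
  unfold dig
  rw [Nat.div_eq_of_lt (lt_of_lt_of_le h (Nat.pow_le_pow_right (by omega) hj)), Nat.zero_mod]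

lemma sum_lt_pow (hp : 2 ≤ p) (a : ℕ → ℕ) (ha : ∀ j, a j < p) (N : ℕ) : ∑ j ∈ Finset.range N, a j * p ^ j < p ^ N := by
  induction N with
  | zero => simp
  | succ N ih =>
    rw [Finset.sum_range_succ, pow_succ]
    have : a N * p ^ N ≤ (p - 1) * p ^ N := Nat.mul_le_mul_right _ (by have := ha N; omega)
    obtain ⟨p', rfl⟩ : ∃ p', p = p' + 1 := ⟨p - 1, by omega⟩
    simp only [Nat.add_sub_cancel] at this
    nlinarith

lemma ds_block (hp : 2 ≤ p) (B : ℕ) : ∀ (a : ℕ → ℕ), (∀ j, a j < p) →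
    (Nat.digits (p ^ f) (∑ j ∈ Finset.range (f * B), a j * p ^ j)).sum =
      ∑ j ∈ Finset.range (f * B), a j * p ^ (j % f) := by
  induction B with
  | zero => intro a _; simp
  | succ B ih =>
    intro a ha
    have hq : 1 < p ^ f := Nat.one_lt_pow (NeZero.ne f) (by omega)
    rw [show f * (B + 1) = f + f * B by ring, Finset.sum_range_add, Finset.sum_range_add]
    have h1 := ih (fun j => a (f + j)) (fun j => ha _)
    have h2 : ∑ j ∈ Finset.range (f * B), a (f + j) * p ^ (f + j) =
        p ^ f * ∑ j ∈ Finset.range (f * B), a (f + j) * p ^ j := by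
      rw [Finset.mul_sum]; apply Finset.sum_congr rfl; intros; rw [pow_add]; ring
    have h3 : ∑ j ∈ Finset.range f, a j * p ^ (j % f) = ∑ j ∈ Finset.range f, a j * p ^ j := by
      apply Finset.sum_congr rfl; intro j hj; rw [Nat.mod_eq_of_lt (Finset.mem_range.mp hj)]
    have h4 := sum_lt_pow hp a ha f
    rw [h2, h3]
    have h5 : ∑ j ∈ Finset.range (f * B), a (f + j) * p ^ ((f + j) % f) =
      ∑ j ∈ Finset.range (f * B), a (f + j) * p ^ (j % f) := by
      apply Finset.sum_congr rfl; intro j hj; rw [Nat.add_mod_left]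
    rw [h5, ← h1]
    generalize ∑ j ∈ Finset.range f, a j * p ^ j = c at *
    generalize ∑ j ∈ Finset.range (f * B), a (f + j) * p ^ j = m at *
    by_cases h0 : c + p ^ f * m = 0
    · have hc : c = 0 := by omega
      have hm : p ^ f * m = 0 := by omega
      have hm' : m = 0 := (Nat.mul_eq_zero.mp hm).resolve_left (by omega)
      subst hc; subst hm'; simp
    · rw [Nat.digits_def' hq (Nat.pos_of_ne_zero h0), List.sum_cons, Nat.add_mul_mod_self_left,
        Nat.mod_eq_of_lt h4, Nat.add_mul_div_left _ _ (by omega), Nat.div_eq_of_lt h4, zero_add]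

lemma ds_eq (hp : 2 ≤ p) {k L : ℕ} (hkL : k < p ^ L) (i : ℕ) :
    ((Nat.digits (p ^ f) (k * p ^ i)).sum : ℤ) = YY p L (dig p k) (-(i : ZMod f)) := by
  have hf : 0 < f := Nat.pos_of_ne_zero (NeZero.ne f)
  let a : ℕ → ℕ := fun j => if j < i then 0 else dig p k (j - i)
  have ha : ∀ j, a j < p := by
    intro j; simp only [a]; split_ifs
    · omega
    · exact Nat.mod_lt _ (by omega)
  have hai : ∀ j, a (i + j) = dig p k j := by intro j; simp [a]
  obtain ⟨N, hN⟩ : ∃ N, f * (L + i) = i + (L + N) := ⟨f * (L + i) - i - L, by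
    have : 1 * (L + i) ≤ f * (L + i) := Nat.mul_le_mul_right _ hf
    omega⟩
  have hb := ds_block (f := f) hp (L + i) a ha
  rw [hN, Finset.sum_range_add _ i (L + N), Finset.sum_range_add _ i (L + N)] at hb
  have z1 : ∑ j ∈ Finset.range i, a j * p ^ j = 0 := by
    apply Finset.sum_eq_zero; intro j hj; simp [a, Finset.mem_range.mp hj]
  have z2 : ∑ j ∈ Finset.range i, a j * p ^ (j % f) = 0 := by
    apply Finset.sum_eq_zero; intro j hj; simp [a, Finset.mem_range.mp hj]
  rw [z1, z2, zero_add, zero_add] at hb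
  simp only [hai] at hb
  have e1 : ∑ j ∈ Finset.range (L + N), dig p k j * p ^ (i + j) = k * p ^ i := by
    have := dig_sum p k (L + N)
    rw [Nat.mod_eq_of_lt (lt_of_lt_of_le hkL (Nat.pow_le_pow_right (by omega) (by omega)))] at this
    conv_rhs => rw [← this]
    rw [Finset.sum_mul]
    apply Finset.sum_congr rfl; intros; rw [pow_add]; ring
  rw [e1, Finset.sum_range_add _ L N] at hb
  have e2 : ∑ x ∈ Finset.range N, dig p k (L + x) * p ^ ((i + (L + x)) % f) = 0 := by
    apply Finset.sum_eq_zero; intro j hj; rw [dig_zero hp hkL (by omega), zero_mul]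
  rw [hb, e2, add_zero]
  unfold YY
  push_cast
  apply Finset.sum_congr rfl
  intro j _
  rw [sub_neg_eq_add, ← Nat.cast_add, ZMod.val_natCast, add_comm j i]

end units
end PS

namespace PS
set_option linter.unusedSectionVars false
section units
variable {f : ℕ} [NeZero f] {p : ℕ}

def kt (L : ℕ) (κ : ℕ → ℕ) (j : ℕ) : ℕ := if j < L then κ j else 1

def cum (L : ℕ) (κ : ℕ → ℕ) (e : ZMod f) (n : ℕ) : ℕ :=
  ∑ j ∈ Finset.range n, if (j : ZMod f) = e then kt L κ j else 0

noncomputable def ps (L : ℕ) (κ : ℕ → ℕ) (e : ZMod f) (ρ : ℕ) : ℕ := sInf {j | ρ < cum L κ e (j + 1)}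

variable {L : ℕ} {κ : ℕ → ℕ}

lemma cum_mono (e : ZMod f) : Monotone (cum L κ e) := by
  intro a b hab
  unfold cum
  exact Finset.sum_le_sum_of_subset (Finset.range_mono hab)

lemma cum_succ (e : ZMod f) (n : ℕ) : cum L κ e (n + 1) = cum L κ e n + if (n : ZMod f) = e then kt L κ n else 0 :=
  Finset.sum_range_succ _ _

lemma ps_ex (e : ZMod f) (ρ : ℕ) : {j | ρ < cum L κ e (j + 1)}.Nonempty := by
  induction ρ with
  | zero =>
    refine ⟨L + (e - (L : ZMod f)).val, ?_⟩
    have h : ((L + (e - (L : ZMod f)).val : ℕ) : ZMod f) = e := by push_cast; exact (cyc _ _).symm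
    simp only [Set.mem_ofPred_eq]
    rw [cum_succ, if_pos h, kt, if_neg (by omega)]; omega
  | succ ρ ih =>
    obtain ⟨j, hj⟩ := ih
    simp only [Set.mem_ofPred_eq] at hj
    set N := L + j + 1 with hN
    refine ⟨N + (e - (N : ZMod f)).val, ?_⟩
    have h : ((N + (e - (N : ZMod f)).val : ℕ) : ZMod f) = e := by push_cast; exact (cyc _ _).symm
    simp only [Set.mem_ofPred_eq]
    rw [cum_succ, if_pos h, kt, if_neg (by omega)]
    have := cum_mono (L := L) (κ := κ) e (show j + 1 ≤ N + (e - (N : ZMod f)).val by omega)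
    omega

lemma ps_spec (e : ZMod f) (ρ : ℕ) : ρ < cum L κ e (ps L κ e ρ + 1) := Nat.sInf_mem (ps_ex e ρ)

lemma ps_le {e : ZMod f} {ρ j : ℕ} (h : ρ < cum L κ e (j + 1)) : ps L κ e ρ ≤ j := Nat.sInf_le h

lemma ps_spec2 (e : ZMod f) (ρ : ℕ) : cum L κ e (ps L κ e ρ) ≤ ρ := by
  by_contra h
  push Not at h
  rcases Nat.eq_zero_or_pos (ps L κ e ρ) with h0 | h0
  · rw [h0] at h; simp [cum] at h
  · have := ps_le (L := L) (κ := κ) (e := e) (ρ := ρ) (j := ps L κ e ρ - 1)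
      (by rwa [show ps L κ e ρ - 1 + 1 = ps L κ e ρ by omega])
    omega

lemma ps_cls (e : ZMod f) (ρ : ℕ) : ((ps L κ e ρ : ℕ) : ZMod f) = e := by
  by_contra h
  have h1 := ps_spec (L := L) (κ := κ) e ρ
  have h2 := ps_spec2 (L := L) (κ := κ) e ρ
  rw [cum_succ, if_neg h] at h1
  omega

lemma cum_gap (hp : 2 ≤ p) (hκ : ∀ j, κ j < p) (e : ZMod f) (n : ℕ) : cum L κ e (n + f) ≤ cum L κ e n + (p - 1) := by
  unfold cum
  rw [Finset.sum_range_add]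
  apply Nat.add_le_add_left
  have h1 : ∀ m ∈ Finset.range f, (if ((n + m : ℕ) : ZMod f) = e then kt L κ (n + m) else 0) ≤
      if m = (e - n : ZMod f).val then p - 1 else 0 := by
    intro m hm
    rw [Finset.mem_range] at hm
    by_cases h : ((n + m : ℕ) : ZMod f) = e
    · have h2 : m = (e - n : ZMod f).val := by
        rw [← h]; push_cast
        rw [add_sub_cancel_left, ZMod.val_natCast, Nat.mod_eq_of_lt hm]
      rw [if_pos h, if_pos h2]
      unfold kt
      have := hκ (n + m)
      split_ifs <;> omega
    · rw [if_neg h]; exact Nat.zero_le _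
  refine (Finset.sum_le_sum h1).trans ?_
  rw [Finset.sum_ite_eq']
  split_ifs <;> omega

lemma ps_good (hp : 2 ≤ p) (hκ : ∀ j, κ j < p) : Good p (ps (f := f) L κ) where
  hp := hp
  mono := fun e a b hab => ps_le (lt_of_le_of_lt hab (ps_spec e b))
  cls := ps_cls
  gap := by
    intro e ρ
    by_contra h
    push Not at h
    have h1 := ps_spec (L := L) (κ := κ) e (ρ + (p - 1))
    have h2 := ps_spec2 (L := L) (κ := κ) e ρ
    have h3 := cum_gap (L := L) hp hκ e (ps L κ e ρ)
    have h4 := cum_mono (L := L) (κ := κ) e (show ps L κ e (ρ + (p - 1)) + 1 ≤ ps L κ e ρ + f by omega)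
    omega

/-- partial class counts -/
lemma gg_le_class (hp : 2 ≤ p) (w : ℕ → ℕ) (hw : ∀ j < L, w j ≤ κ j) (e : ZMod f) : ∀ n ≤ L,
    gg p (ps L κ) e (Gam n w e) ≤ ∑ j ∈ Finset.range n, if (j : ZMod f) = e then (w j : ℤ) * (p : ℤ) ^ j else 0 := by
  intro n
  induction n with
  | zero => intro _; simp [Gam, gg_zero]
  | succ n ih =>
    intro hn
    have ih := ih (by omega)
    rw [Finset.sum_range_succ]
    have hG : Gam (n + 1) w e = Gam n w e + if (n : ZMod f) = e then (w n : ℤ) else 0 := Finset.sum_range_succ _ _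
    rw [hG]
    by_cases h : (n : ZMod f) = e
    · rw [if_pos h, if_pos h]
      have hstep : ∀ m : ℕ, m ≤ w n → gg p (ps L κ) e (Gam n w e + m) ≤ gg p (ps L κ) e (Gam n w e) + m * (p : ℤ) ^ n := by
        intro m
        induction m with
        | zero => intro _; simp
        | succ m ihm =>
          intro hm
          have ihm := ihm (by omega)
          have h0 := Gam_nonneg n w e
          push_cast
          rw [← add_assoc, gg_succ e (by positivity)]
          have hle : ps L κ e (Gam n w e + (m : ℤ)).toNat ≤ n := by
            apply ps_le
            have hc : Gam n w e ≤ (cum L κ e n : ℤ) := by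
              unfold Gam cum
              push_cast
              apply Finset.sum_le_sum
              intro j hj
              rw [Finset.mem_range] at hj
              have := hw j (by omega)
              split_ifs
              · unfold kt; rw [if_pos (by omega)]; exact_mod_cast this
              · exact le_rfl
            rw [cum_succ, if_pos h, kt, if_pos (by omega)]
            have := hw n (by omega)
            omega
          have := pow_le_pow_right₀ (show (1:ℤ) ≤ p by exact_mod_cast (by omega : 1 ≤ p)) hle
          linarith
      have := hstep (w n) le_rfl
      linarith
    · rw [if_neg h, if_neg h, add_zero, add_zero]; exact ih

lemma sum_class (g : ℕ → ℤ) : ∑ e : ZMod f, ∑ j ∈ Finset.range L, (if (j : ZMod f) = e then g j else 0) =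
    ∑ j ∈ Finset.range L, g j := by
  rw [Finset.sum_comm]
  apply Finset.sum_congr rfl
  intro j _
  simp

lemma sum_gg_le (hp : 2 ≤ p) (w : ℕ → ℕ) (hw : ∀ j < L, w j ≤ κ j) :
    ∑ e : ZMod f, gg p (ps L κ) e (Gam L w e) ≤ nn p L w := by
  calc _ ≤ ∑ e : ZMod f, ∑ j ∈ Finset.range L, (if (j : ZMod f) = e then (w j : ℤ) * (p : ℤ) ^ j else 0) :=
        Finset.sum_le_sum fun e _ => gg_le_class hp w hw e L le_rfl
    _ = _ := by rw [sum_class]; unfold nn; push_cast; rfl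

lemma FF_le_nn (hp : 2 ≤ p) (w : ℕ → ℕ) (hw : ∀ j < L, w j ≤ κ j) (x : ZMod f → ℤ)
    (hx : ∀ c, ee p x c = Gam L w c) : FF p (ps L κ) x ≤ nn p L w := by
  unfold FF; simp only [hx]; exact sum_gg_le hp w hw

/-- sorted digit vector -/
noncomputable def ws (L : ℕ) (κ : ℕ → ℕ) (u : ZMod f → ℤ) (j : ℕ) : ℕ :=
  ((Finset.range (u (j : ZMod f)).toNat).filter fun ρ => ps L κ (j : ZMod f) ρ = j).card

lemma ws_le (u : ZMod f → ℤ) {j : ℕ} (hj : j < L) : ws L κ u j ≤ κ j := by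
  unfold ws
  calc _ ≤ (Finset.Ico (cum L κ (j : ZMod f) j) (cum L κ (j : ZMod f) (j + 1))).card := by
        apply Finset.card_le_card
        intro ρ hρ
        simp only [Finset.mem_filter] at hρ
        rw [Finset.mem_Ico]
        have h1 := ps_spec (L := L) (κ := κ) (j : ZMod f) ρ
        have h2 := ps_spec2 (L := L) (κ := κ) (j : ZMod f) ρ
        rw [hρ.2] at h1 h2
        exact ⟨h2, h1⟩
    _ = κ j := by
        rw [Nat.card_Ico, cum_succ, if_pos rfl, kt, if_pos hj]; omega

lemma ws_mono {u v : ZMod f → ℤ} (h : ∀ e, u e ≤ v e) (j : ℕ) : ws L κ u j ≤ ws L κ v j := by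
  unfold ws
  apply Finset.card_le_card
  apply Finset.filter_subset_filter
  apply Finset.range_mono
  have := h (j : ZMod f)
  omega

lemma ws_Gam (u : ZMod f → ℤ) (hu : ∀ e, 0 ≤ u e) (hL : ∀ e, ∀ ρ < (u e).toNat, ps L κ e ρ < L) (e : ZMod f) :
    Gam L (ws L κ u) e = u e := by
  have h1 := Finset.card_eq_sum_card_fiberwise (f := ps L κ e) (s := Finset.range (u e).toNat) (t := Finset.range L)
    (fun ρ hρ => by simpa using hL e ρ (by simpa using hρ))
  rw [Finset.card_range] at h1
  have h2 : (u e) = ((u e).toNat : ℤ) := by have := hu e; omega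
  rw [h2, h1]
  unfold Gam
  push_cast
  apply Finset.sum_congr rfl
  intro j _
  split_ifs with h
  · unfold ws; rw [h]
  · symm
    rw [Int.natCast_eq_zero, Finset.card_eq_zero, Finset.filter_eq_empty_iff]
    intro ρ _ h3
    exact h (by rw [← h3]; exact ps_cls e ρ)

lemma ws_nn (u : ZMod f → ℤ) (hL : ∀ e, ∀ ρ < (u e).toNat, ps L κ e ρ < L) :
    (nn p L (ws L κ u) : ℤ) = ∑ e, gg p (ps L κ) e (u e) := by
  have h0 : (nn p L (ws L κ u) : ℤ) = ∑ j ∈ Finset.range L, (ws L κ u j : ℤ) * (p : ℤ) ^ j := by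
    unfold nn; push_cast; rfl
  rw [h0, ← sum_class (f := f)]
  apply Finset.sum_congr rfl
  intro e _
  unfold gg
  rw [← Finset.sum_fiberwise_of_maps_to (s := Finset.range (u e).toNat) (g := ps L κ e) (t := Finset.range L) (fun ρ hρ => by simpa using hL e ρ (by simpa using hρ))]
  apply Finset.sum_congr rfl
  intro j _
  have h1 : ∑ ρ ∈ (Finset.range (u e).toNat).filter (fun ρ => ps L κ e ρ = j), (p : ℤ) ^ (ps L κ e ρ) =
      ∑ ρ ∈ (Finset.range (u e).toNat).filter (fun ρ => ps L κ e ρ = j), (p : ℤ) ^ j := by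
    apply Finset.sum_congr rfl
    intro ρ hρ
    rw [(Finset.mem_filter.mp hρ).2]
  rw [h1, Finset.sum_const, nsmul_eq_mul]
  split_ifs with h
  · unfold ws; rw [h]
  · have : (Finset.range (u e).toNat).filter (fun ρ => ps L κ e ρ = j) = ∅ := by
      rw [Finset.filter_eq_empty_iff]
      intro ρ _ h3
      exact h (by rw [← h3]; exact ps_cls e ρ)
    rw [this]; simp

/-- units of small cost have small positions -/
lemma ps_small (hp : 2 ≤ p) {u : ZMod f → ℤ} (h : ∑ e, gg p (ps L κ) e (u e) < (p : ℤ) ^ L) (e : ZMod f) :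
    ∀ ρ < (u e).toNat, ps L κ e ρ < L := by
  intro ρ hρ
  by_contra hcon
  push Not at hcon
  have hp1 : (1:ℤ) ≤ p := by exact_mod_cast (by omega : 1 ≤ p)
  have h1 : gg p (ps L κ) e (u e) ≤ ∑ e, gg p (ps L κ) e (u e) :=
    Finset.single_le_sum (f := fun e => gg p (ps L κ) e (u e)) (fun i _ => gg_nonneg i _) (Finset.mem_univ e)
  have h2 : (p : ℤ) ^ (ps L κ e ρ) ≤ gg p (ps L κ) e (u e) :=
    Finset.single_le_sum (f := fun ρ => (p : ℤ) ^ (ps L κ e ρ)) (fun i _ => by positivity) (Finset.mem_range.mpr hρ)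
  have h3 := pow_le_pow_right₀ hp1 hcon
  linarith

end units
end PS

namespace PS
set_option linter.unusedSectionVars false
section units
variable {f : ℕ} [NeZero f] {p : ℕ}

lemma sum_lt_pow' (hp : 2 ≤ p) (a : ℕ → ℕ) (N : ℕ) (ha : ∀ j < N, a j < p) : ∑ j ∈ Finset.range N, a j * p ^ j < p ^ N := by
  have := sum_lt_pow hp (fun j => if j < N then a j else 0) (fun j => by
    by_cases h : j < N
    · simp only [h, if_true]; exact ha j h
    · simp only [h, if_false]; omega) N
  refine lt_of_eq_of_lt (Finset.sum_congr rfl fun j hj => ?_) this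
  rw [if_pos (Finset.mem_range.mp hj)]

lemma dig_unique (hp : 2 ≤ p) (a b : ℕ → ℕ) (N : ℕ) (ha : ∀ j < N, a j < p) (hb : ∀ j < N, b j < p)
    (h : nn p N a = nn p N b) : ∀ j < N, a j = b j := by
  induction N with
  | zero => intro j hj; omega
  | succ N ih =>
    have h1 := sum_lt_pow' hp a N (fun j hj => ha j (by omega))
    have h2 := sum_lt_pow' hp b N (fun j hj => hb j (by omega))
    have hpos : 0 < p ^ N := by positivity
    unfold nn at h
    rw [Finset.sum_range_succ, Finset.sum_range_succ] at h
    have hN : a N = b N := by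
      have e1 := congrArg (· / p ^ N) h
      simp only [Nat.add_mul_div_right _ _ hpos, Nat.div_eq_of_lt h1, Nat.div_eq_of_lt h2, zero_add] at e1
      exact e1
    have hr : nn p N a = nn p N b := by
      unfold nn; rw [hN] at h; omega
    intro j hj
    rcases Nat.lt_succ_iff_lt_or_eq.mp hj with h' | h'
    · exact ih (fun j hj => ha j (by omega)) (fun j hj => hb j (by omega)) hr j h'
    · rw [h']; exact hN

structure Adm (p f d L : ℕ) (κ : ℕ → ℕ) (W : ℕ → ℕ → ℕ) : Prop where
  pos : ∀ i < d, 0 < nn p L (W i)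
  dvd : ∀ i < d, ((p : ℤ) ^ f - 1) ∣ (nn p L (W i) : ℤ)
  le : ∀ j < L, ∑ i ∈ Finset.range d, W i j ≤ κ j

def wr (W : ℕ → ℕ → ℕ) (r j : ℕ) : ℕ := ∑ i ∈ Finset.range r, W i j

def SS (p d L : ℕ) (W : ℕ → ℕ → ℕ) : ℕ := ∑ r ∈ Finset.range (d + 1), nn p L (wr W r)

variable {d L : ℕ} {κ : ℕ → ℕ}

lemma wr_le {W : ℕ → ℕ → ℕ} (hW : Adm p f d L κ W) {r : ℕ} (hr : r ≤ d) {j : ℕ} (hj : j < L) : wr W r j ≤ κ j :=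
  le_trans (Finset.sum_le_sum_of_subset (Finset.range_mono hr)) (hW.le j hj)

lemma Gam_wr (W : ℕ → ℕ → ℕ) (r : ℕ) (c : ZMod f) :
    Gam L (wr W (r + 1)) c = Gam L (wr W r) c + Gam L (W r) c := by
  unfold Gam
  rw [← Finset.sum_add_distrib]
  apply Finset.sum_congr rfl
  intro j _
  unfold wr
  rw [Finset.sum_range_succ]
  split_ifs <;> push_cast <;> ring

lemma chain_of_cols (hp : 2 ≤ p) {W : ℕ → ℕ → ℕ} (hW : Adm p f d L κ W) :
    ∃ x : ℕ → ZMod f → ℤ, Feas p d x ∧ ∀ r ≤ d, ∀ c, ee p (x r) c = Gam L (wr W r) c := by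
  have hex : ∀ i, ∃ x : ZMod f → ℤ, i < d → (∀ c, ee p x c = Gam L (W i) c) ∧ ∀ c, 1 ≤ x c := by
    intro i
    by_cases hi : i < d
    · obtain ⟨x, h1, -, h3⟩ := YY_dvd (f := f) hp L (W i) (hW.dvd i hi)
      exact ⟨x, fun _ => ⟨h1, h3 (hW.pos i hi)⟩⟩
    · exact ⟨0, fun h => absurd h hi⟩
  choose ξ hξ using hex
  let x : ℕ → ZMod f → ℤ := fun r c => ∑ i ∈ Finset.range r, ξ i c
  have hs : ∀ r c, x (r + 1) c = x r c + ξ r c := fun r c => Finset.sum_range_succ _ _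
  have hee : ∀ r ≤ d, ∀ c, ee p (x r) c = Gam L (wr W r) c := by
    intro r
    induction r with
    | zero => intro _ c; simp [x, ee, Gam, wr]
    | succ r ih =>
      intro hr c
      rw [Gam_wr, ← ih (by omega) c, ← (hξ r (by omega)).1 c]
      unfold ee
      rw [hs, hs]; ring
  refine ⟨x, ⟨by ext c; simp [x], fun r hr c => ?_, fun r hr c => ?_⟩, hee⟩
  · rw [hs]; have := (hξ r hr).2 c; linarith
  · rw [hee r hr]; exact Gam_nonneg _ _ _

theorem partA (hp : 2 ≤ p) {W : ℕ → ℕ → ℕ} (hW : Adm p f d L κ W) (c : ZMod f) :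
    (d : ℤ) * ((p : ℤ) ^ f - 1) ≤ YY p L κ c := by
  obtain ⟨x, hx, hee⟩ := chain_of_cols hp hW
  have h1 := YY_of hp L (wr W d) (x d) (hee d le_rfl) c
  have h2 := hx.ge d le_rfl c
  have h3 : YY p L (wr W d) c ≤ YY p L κ c := by
    unfold YY
    apply Finset.sum_le_sum
    intro j hj
    apply mul_le_mul_of_nonneg_right _ (by positivity)
    exact_mod_cast wr_le hW le_rfl (Finset.mem_range.mp hj)
  have hq := q_pos' (f := f) hp
  nlinarith

theorem partB (hp : 2 ≤ p) {k : ℕ} (hk : (d + 1) * k < p ^ L)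
    (h : ∀ c : ZMod f, (d : ℤ) * ((p : ℤ) ^ f - 1) ≤ YY p L (dig p k) c) :
    ∃ W0, Adm p f d L (dig p k) W0 ∧ ∀ W, Adm p f d L (dig p k) W → SS p d L W = SS p d L W0 →
      ∀ i < d, ∀ j < L, W i j = W0 i j := by
  set κ := dig p k with hκdef
  have hκ : ∀ j, κ j < p := fun j => Nat.mod_lt _ (by omega)
  have hkL : k < p ^ L := by nlinarith
  have hnk : nn p L κ = k := by unfold nn; rw [hκdef, dig_sum, Nat.mod_eq_of_lt hkL]
  have hG := ps_good (f := f) (L := L) hp hκ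
  set pos := ps (f := f) L κ with hpos
  obtain ⟨x, hx⟩ := exists_isMin (f := f) (pos := pos) hp d
  have hcost : cost p d pos x < (p : ℤ) ^ L := by
    obtain ⟨X, hX1, hX2⟩ := bockle hp (Gam (f := f) L κ) (Gam_nonneg L κ) d (fun c => by rw [tele_Gam hp]; exact h c)
    obtain ⟨y, hy, -, hyΓ⟩ := chain_of hp (Gam (f := f) L κ) (Gam_nonneg L κ) d X hX1 hX2
    have h1 : cost p d pos y ≤ ∑ r ∈ Finset.range (d + 1), (k : ℤ) := by
      unfold cost
      apply Finset.sum_le_sum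
      intro r hr
      calc FF p pos (y r) ≤ ∑ e, gg p pos e (Gam L κ e) :=
            Finset.sum_le_sum fun e _ => gg_mono e (hyΓ r (by have := Finset.mem_range.mp hr; omega) e)
        _ ≤ nn p L κ := sum_gg_le hp κ (fun _ _ => le_rfl)
        _ = k := by rw [hnk]
    rw [Finset.sum_const, Finset.card_range, nsmul_eq_mul] at h1
    have h2 := hx.2 y hy
    have h3 : (((d + 1 : ℕ) : ℤ) * (k : ℤ)) < (p : ℤ) ^ L := by exact_mod_cast hk
    linarith
  have hFFr : ∀ r ≤ d, FF p pos (x r) < (p : ℤ) ^ L := by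
    intro r hr
    refine lt_of_le_of_lt ?_ hcost
    exact Finset.single_le_sum (f := fun r => FF p pos (x r)) (fun i _ => FF_nonneg _) (Finset.mem_range.mpr (by omega))
  have hsm : ∀ r ≤ d, ∀ e, ∀ ρ < (ee p (x r) e).toNat, pos e ρ < L := fun r hr e => ps_small hp (hFFr r hr) e
  set w : ℕ → ℕ → ℕ := fun r => ws L κ (ee p (x r)) with hw
  have hwG : ∀ r ≤ d, ∀ c, Gam L (w r) c = ee p (x r) c := fun r hr c =>
    ws_Gam _ (hx.1.nonneg r hr) (hsm r hr) c
  have hwn : ∀ r ≤ d, (nn p L (w r) : ℤ) = FF p pos (x r) := fun r hr => ws_nn _ (hsm r hr)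
  have hwκ : ∀ r, ∀ j < L, w r j ≤ κ j := fun r j hj => ws_le _ hj
  have hwm : ∀ r < d, ∀ j, w r j ≤ w (r + 1) j := fun r hr j => ws_mono (nested hG hx r hr) j
  have hw0 : ∀ j, w 0 j = 0 := by
    intro j
    have h1 : ee p (x 0) = 0 := by ext e; rw [hx.1.zero]; simp [ee]
    simp only [hw]; rw [h1]; simp [ws]
  let W0 : ℕ → ℕ → ℕ := fun i j => w (i + 1) j - w i j
  have hwr : ∀ r ≤ d, wr W0 r = w r := by
    intro r
    induction r with
    | zero => intro _; ext j; simp [wr, hw0]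
    | succ r ih =>
      intro hr
      ext j
      have h1 := congrFun (ih (by omega)) j
      have h2 := hwm r (by omega) j
      unfold wr at h1 ⊢
      rw [Finset.sum_range_succ, h1]
      simp only [W0]; omega
  have hGW : ∀ i < d, ∀ c, ee p (fun e => x (i + 1) e - x i e) c = Gam L (W0 i) c := by
    intro i hi c
    rw [ee_sub, ← hwG _ (by omega), ← hwG i (by omega), ← hwr (i + 1) (by omega), Gam_wr, hwr i (by omega)]
    ring
  have hadm : ∀ i < d, ((p : ℤ) ^ f - 1) ∣ (nn p L (W0 i) : ℤ) ∧ 0 < nn p L (W0 i) := fun i hi =>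
    nn_of hp L (W0 i) _ (hGW i hi) (by have := hx.1.step i hi 0; linarith)
  refine ⟨W0, ⟨fun i hi => (hadm i hi).2, fun i hi => (hadm i hi).1, fun j hj => ?_⟩, ?_⟩
  · have := congrFun (hwr d le_rfl) j
    unfold wr at this
    rw [this]; exact hwκ d j hj
  · intro W hW hSS
    obtain ⟨x', hx', hee'⟩ := chain_of_cols hp hW
    have hle : ∀ r ≤ d, FF p pos (x' r) ≤ nn p L (wr W r) := fun r hr =>
      FF_le_nn hp _ (fun j hj => wr_le hW hr hj) _ (hee' r hr)
    have hS0 : (SS p d L W0 : ℤ) = cost p d pos x := by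
      unfold SS cost; push_cast
      apply Finset.sum_congr rfl
      intro r hr
      rw [Finset.mem_range] at hr
      rw [hwr r (by omega), hwn r (by omega)]
    have hS : (SS p d L W : ℤ) = ∑ r ∈ Finset.range (d + 1), (nn p L (wr W r) : ℤ) := by unfold SS; push_cast; rfl
    have hle' : ∀ r ∈ Finset.range (d + 1), FF p pos (x' r) ≤ (nn p L (wr W r) : ℤ) := fun r hr =>
      hle r (by have := Finset.mem_range.mp hr; omega)
    have hc' : cost p d pos x' ≤ cost p d pos x := by
      rw [← hS0, ← hSS, hS]; exact Finset.sum_le_sum hle'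
    have hmin' : IsMin p d pos x' := ⟨hx', fun y hy => hc'.trans (hx.2 y hy)⟩
    have hxx := unique_min hG hx hmin'
    have heq : ∑ r ∈ Finset.range (d + 1), FF p pos (x' r) = ∑ r ∈ Finset.range (d + 1), (nn p L (wr W r) : ℤ) := by
      rw [← hS, hSS, hS0]
      exact le_antisymm hc' (hx.2 x' hx')
    have hterm := (Finset.sum_eq_sum_iff_of_le hle').mp heq
    have hww : ∀ r ≤ d, ∀ j < L, wr W r j = w r j := by
      intro r hr
      apply dig_unique hp _ _ L (fun j hj => lt_of_le_of_lt (wr_le hW hr hj) (hκ j))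
        (fun j hj => lt_of_le_of_lt (hwκ r j hj) (hκ j))
      have h1 := hterm r (Finset.mem_range.mpr (by omega))
      rw [← hxx r hr, ← hwn r hr] at h1
      exact_mod_cast h1.symm
    intro i hi j hj
    have h1 := hww (i + 1) (by omega) j hj
    have h2 := hww i (by omega) j hj
    have h3 : wr W (i + 1) j = wr W i j + W i j := Finset.sum_range_succ _ _
    simp only [W0]
    omega

end units
end PS

namespace PS
set_option linter.unusedSectionVars false
section alg
open Polynomial

def TT (p k d L : ℕ) : Finset (Fin L → Fin (d + 1) → ℕ) :=
  Fintype.piFinset (fun j : Fin L => (Finset.univ : Finset (Fin (d + 1))).piAntidiag (dig p k j))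

def mm (p : ℕ) {d L : ℕ} (M : Fin L → Fin (d + 1) → ℕ) (i : Fin (d + 1)) : ℕ :=
  ∑ j, M j i * p ^ (j : ℕ)

def EE (p : ℕ) {d L : ℕ} (M : Fin L → Fin (d + 1) → ℕ) : ℕ :=
  ∑ i : Fin (d + 1), (i : ℕ) * mm p M i

def vv (p : ℕ) (Fq : Type) [Field Fq] [Fintype Fq] {d L : ℕ} (M : Fin L → Fin (d + 1) → ℕ) : Fq :=
  (∏ j, (Nat.multinomial Finset.univ (M j) : Fq)) * ∏ i : Fin d, ∑ x : Fq, x ^ mm p M i.castSucc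

lemma mem_TT {p k d L : ℕ} {M : Fin L → Fin (d + 1) → ℕ} :
    M ∈ TT p k d L ↔ ∀ j : Fin L, ∑ i, M j i = dig p k j := by
  simp [TT, Fintype.mem_piFinset, Finset.mem_piAntidiag]

lemma expand {R : Type*} [CommRing R] {p : ℕ} [ExpChar R p] {k L d : ℕ} (hk : k < p ^ L)
    (y : Fin (d + 1) → R) :
    (∑ i, y i) ^ k = ∑ M ∈ TT p k d L,
      (∏ j, (Nat.multinomial Finset.univ (M j) : R)) * ∏ i, y i ^ mm p M i := by
  have h1 : k = ∑ j : Fin L, p ^ (j : ℕ) * dig p k j := by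
    have := dig_sum p k L
    rw [Nat.mod_eq_of_lt hk, Finset.sum_range] at this
    conv_lhs => rw [← this]
    exact Finset.sum_congr rfl fun j _ => mul_comm _ _
  have h2 : (∑ i, y i) ^ k = ∏ j : Fin L, ∑ m ∈ (Finset.univ : Finset (Fin (d + 1))).piAntidiag (dig p k j),
      ((Nat.multinomial Finset.univ m : R) * ∏ i, (y i ^ p ^ (j : ℕ)) ^ m i) := by
    conv_lhs => rw [h1]
    rw [← Finset.prod_pow_eq_pow_sum]
    refine Finset.prod_congr rfl fun j _ => ?_
    rw [pow_mul, sum_pow_char_pow, Finset.sum_pow_eq_sum_piAntidiag]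
  rw [h2, Finset.prod_univ_sum]
  refine Finset.sum_congr rfl fun M _ => ?_
  rw [Finset.prod_mul_distrib]
  congr 1
  rw [Finset.prod_comm]
  refine Finset.prod_congr rfl fun i _ => ?_
  rw [mm, ← Finset.prod_pow_eq_pow_sum]
  refine Finset.prod_congr rfl fun j _ => ?_
  rw [← pow_mul, mul_comm]

lemma psum_expand (p : ℕ) (Fq : Type) [Field Fq] [Fintype Fq] [ExpChar Fq p] {k L d : ℕ} (hk : k < p ^ L) :
    (∑ c : Fin d → Fq, (X ^ d + ∑ i : Fin d, C (c i) * X ^ (i : ℕ)) ^ k : Polynomial Fq)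
      = ∑ M ∈ TT p k d L, C (vv p Fq M) * X ^ EE p M := by
  have h1 : ∀ c : Fin d → Fq, ((X ^ d + ∑ i : Fin d, C (c i) * X ^ (i : ℕ)) ^ k : Polynomial Fq)
      = ∑ M ∈ TT p k d L, C (∏ j, (Nat.multinomial Finset.univ (M j) : Fq)) *
          (C (∏ i : Fin d, c i ^ mm p M i.castSucc) * X ^ EE p M) := by
    intro c
    have h := expand (R := Polynomial Fq) hk
      (Fin.snoc (α := fun _ => Polynomial Fq) (fun i : Fin d => C (c i) * X ^ (i : ℕ)) (X ^ d))
    rw [Fin.sum_univ_castSucc] at h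
    simp only [Fin.snoc_castSucc, Fin.snoc_last] at h
    rw [add_comm, h]
    refine Finset.sum_congr rfl fun M _ => ?_
    congr 1
    · simp
    · rw [Fin.prod_univ_castSucc]
      simp only [Fin.snoc_castSucc, Fin.snoc_last]
      simp only [mul_pow, Finset.prod_mul_distrib, ← pow_mul, Finset.prod_pow_eq_pow_sum]
      rw [EE, Fin.sum_univ_castSucc, pow_add]
      simp [mul_assoc]
  simp only [h1]
  rw [Finset.sum_comm]
  refine Finset.sum_congr rfl fun M _ => ?_
  rw [← Finset.mul_sum, ← Finset.sum_mul, ← map_sum, ← mul_assoc, ← C_mul, vv, Finset.prod_univ_sum, Fintype.piFinset_univ]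

lemma sig_ne {p f : ℕ} (hp : p.Prime) (hf : 0 < f) (Fq : Type) [Field Fq] [Fintype Fq]
    (hcard : Fintype.card Fq = p ^ f) (m : ℕ) :
    (∑ x : Fq, x ^ m) ≠ 0 ↔ 0 < m ∧ ((p : ℤ) ^ f - 1) ∣ (m : ℤ) := by
  classical
  have e : ((p : ℤ) ^ f - 1) ∣ (m : ℤ) ↔ (Fintype.card Fq - 1) ∣ m := by
    rw [hcard, ← Int.natCast_dvd_natCast, Nat.cast_sub (Nat.one_le_pow _ _ hp.pos)]
    simp
  rw [e]
  rcases Nat.eq_zero_or_pos m with rfl | hm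
  · simp
  · have h := FiniteField.sum_pow_units Fq m
    have h2 : (∑ x : Fq, x ^ m) = ∑ x : Fqˣ, (x : Fq) ^ m := by
      rw [Fintype.sum_eq_add_sum_compl 0, zero_pow hm.ne', zero_add]
      symm
      refine Finset.sum_bij (fun (x : Fqˣ) _ => (x : Fq)) ?_ ?_ ?_ ?_
      · intro a _; simp
      · intro a _ b _ h; exact Units.ext h
      · intro b hb
        have hb' : b ≠ 0 := by simpa using hb
        exact ⟨Units.mk0 b hb', Finset.mem_univ _, rfl⟩
      · intro a _; rfl
    rw [h2, h]
    split_ifs with h3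
    · simp [hm, h3]
    · simp [h3]

lemma mult_ne {p k d L : ℕ} (hp : p.Prime) (Fq : Type) [Field Fq] [CharP Fq p]
    {M : Fin L → Fin (d + 1) → ℕ} (hM : M ∈ TT p k d L) :
    (∏ j, (Nat.multinomial Finset.univ (M j) : Fq)) ≠ 0 := by
  rw [Finset.prod_ne_zero_iff]
  intro j _ h
  rw [CharP.cast_eq_zero_iff Fq p] at h
  have h1 := Nat.multinomial_spec Finset.univ (M j)
  rw [mem_TT.mp hM j] at h1
  have h2 : p ∣ (dig p k j).factorial := by rw [← h1]; exact Dvd.dvd.mul_left h _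
  rw [hp.dvd_factorial] at h2
  have h3 : dig p k j < p := Nat.mod_lt _ hp.pos
  omega

lemma vv_ne {p f k d L : ℕ} (hp : p.Prime) (hf : 0 < f) (Fq : Type) [Field Fq] [Fintype Fq] [CharP Fq p]
    (hcard : Fintype.card Fq = p ^ f) {M : Fin L → Fin (d + 1) → ℕ} (hM : M ∈ TT p k d L) :
    vv p Fq M ≠ 0 ↔ ∀ i : Fin d, 0 < mm p M i.castSucc ∧ ((p : ℤ) ^ f - 1) ∣ (mm p M i.castSucc : ℤ) := by
  rw [vv, mul_ne_zero_iff, and_iff_right (mult_ne hp Fq hM), Finset.prod_ne_zero_iff]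
  constructor
  · intro h i
    exact (sig_ne hp hf Fq hcard _).mp (h i (Finset.mem_univ _))
  · intro h i _
    exact (sig_ne hp hf Fq hcard _).mpr (h i)

def WM {d L : ℕ} (M : Fin L → Fin (d + 1) → ℕ) (i j : ℕ) : ℕ :=
  if h : i < d + 1 ∧ j < L then M ⟨j, h.2⟩ ⟨i, h.1⟩ else 0

lemma WM_eq {d L : ℕ} (M : Fin L → Fin (d + 1) → ℕ) (i : Fin (d + 1)) (j : Fin L) :
    WM M i j = M j i := by
  unfold WM
  rw [dif_pos ⟨i.2, j.2⟩]

lemma nn_WM {p d L : ℕ} (M : Fin L → Fin (d + 1) → ℕ) (i : Fin (d + 1)) :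
    nn p L (WM M i) = mm p M i := by
  rw [nn, mm, Finset.sum_range]
  simp only [WM_eq]

lemma row_WM {d L : ℕ} (M : Fin L → Fin (d + 1) → ℕ) (j : Fin L) :
    ∑ i ∈ Finset.range (d + 1), WM M i j = ∑ i, M j i := by
  rw [Finset.sum_range]; simp only [WM_eq]

lemma adm_iff {p f k d L : ℕ} {M : Fin L → Fin (d + 1) → ℕ} (hM : M ∈ TT p k d L) :
    (∀ i : Fin d, 0 < mm p M i.castSucc ∧ ((p : ℤ) ^ f - 1) ∣ (mm p M i.castSucc : ℤ)) ↔
      Adm p f d L (dig p k) (WM M) := by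
  constructor
  · intro h
    refine ⟨fun i hi => ?_, fun i hi => ?_, fun j hj => ?_⟩
    · have := (h ⟨i, hi⟩).1
      rw [← nn_WM] at this; exact this
    · have := (h ⟨i, hi⟩).2
      rw [← nn_WM] at this; exact this
    · have h1 := row_WM M ⟨j, hj⟩
      rw [mem_TT.mp hM, Finset.sum_range_succ] at h1
      simp only at h1
      omega
  · intro h i
    rw [← nn_WM]
    exact ⟨h.pos i i.2, h.dvd i i.2⟩

lemma nn_wr (p L : ℕ) (W : ℕ → ℕ → ℕ) (r : ℕ) :
    nn p L (wr W r) = ∑ i ∈ Finset.range r, nn p L (W i) := by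
  unfold nn wr
  simp only [Finset.sum_mul]
  rw [Finset.sum_comm]

lemma sum_sum_range (a : ℕ → ℕ) (d : ℕ) :
    ∑ i ∈ Finset.range (d + 1), i * a i + ∑ r ∈ Finset.range (d + 1), ∑ i ∈ Finset.range r, a i
      = d * ∑ i ∈ Finset.range (d + 1), a i := by
  induction d with
  | zero => simp
  | succ d ih =>
    rw [Finset.sum_range_succ, Finset.sum_range_succ (fun r => ∑ i ∈ Finset.range r, a i) (d + 1),
      Finset.sum_range_succ a (d + 1)]
    linarith

lemma EE_SS {p k d L : ℕ} (hk : k < p ^ L) {M : Fin L → Fin (d + 1) → ℕ} (hM : M ∈ TT p k d L) :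
    EE p M + SS p d L (WM M) = d * k := by
  have h1 : ∑ i ∈ Finset.range (d + 1), nn p L (WM M i) = k := by
    rw [← nn_wr, nn]
    have := dig_sum p k L
    rw [Nat.mod_eq_of_lt hk] at this
    conv_rhs => rw [← this]
    refine Finset.sum_congr rfl fun j hj => ?_
    rw [wr, row_WM M ⟨j, Finset.mem_range.mp hj⟩, mem_TT.mp hM]
  have h2 := sum_sum_range (fun i => nn p L (WM M i)) d
  simp only [h1] at h2
  unfold SS
  simp only [nn_wr]
  rw [← h2, EE, Finset.sum_range (fun i => i * nn p L (WM M i))]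
  simp only [nn_WM]

theorem psum_ne (p f : ℕ) (hp : p.Prime) (hf : 0 < f)
    (Fq : Type) [Field Fq] [Fintype Fq] (hcard : Fintype.card Fq = p ^ f)
    (k : ℕ) (hk : 0 < k) (d : ℕ) :
    (∑ c : Fin d → Fq, (X ^ d + ∑ i : Fin d, C (c i) * X ^ (i : ℕ)) ^ k : Polynomial Fq) ≠ 0 ↔
      ∀ i < f, (d : ℤ) * ((p : ℤ) ^ f - 1) ≤ ((Nat.digits (p ^ f) (k * p ^ i)).sum : ℤ) := by
  have : NeZero f := ⟨hf.ne'⟩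
  have : Fact p.Prime := ⟨hp⟩
  have : CharP Fq p := by
    have h1 := FiniteField.cast_card_eq_zero Fq
    rw [hcard, Nat.cast_pow] at h1
    have h0 : (p : Fq) = 0 := by simpa [hf.ne'] using h1
    exact (CharP.charP_iff_prime_eq_zero hp).mpr h0
  have : ExpChar Fq p := ExpChar.prime hp
  obtain ⟨L, hL⟩ : ∃ L, (d + 1) * k < p ^ L := ⟨_, Nat.lt_pow_self hp.one_lt⟩
  have hkL : k < p ^ L := lt_of_le_of_lt (by nlinarith) hL
  rw [psum_expand p Fq hkL]
  have hYY : (∀ i < f, (d : ℤ) * ((p : ℤ) ^ f - 1) ≤ ((Nat.digits (p ^ f) (k * p ^ i)).sum : ℤ)) ↔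
      ∀ c : ZMod f, (d : ℤ) * ((p : ℤ) ^ f - 1) ≤ YY p L (dig p k) c := by
    constructor
    · intro h c
      have := h (-c).val (ZMod.val_lt _)
      rw [ds_eq hp.two_le hkL] at this
      simpa using this
    · intro h i _
      rw [ds_eq hp.two_le hkL]
      exact h _
  rw [hYY]
  constructor
  · intro h c
    obtain ⟨M, hM, hM2⟩ := Finset.exists_ne_zero_of_sum_ne_zero h
    have hv : vv p Fq M ≠ 0 := by
      intro h0; rw [h0] at hM2; simp at hM2
    rw [vv_ne hp hf Fq hcard hM, adm_iff hM] at hv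
    exact partA hp.two_le hv c
  · intro h
    obtain ⟨W0, hW0, huniq⟩ := partB hp.two_le hL h
    let M0 : Fin L → Fin (d + 1) → ℕ := fun j => Fin.snoc (α := fun _ => ℕ) (fun i : Fin d => W0 i j)
      (dig p k j - ∑ i ∈ Finset.range d, W0 i j)
    have hM0 : M0 ∈ TT p k d L := by
      rw [mem_TT]
      intro j
      have := hW0.le j j.2
      rw [Fin.sum_univ_castSucc]
      simp only [M0, Fin.snoc_castSucc, Fin.snoc_last]
      rw [Finset.sum_range] at this ⊢
      omega
    have hWM0 : ∀ i < d, ∀ j < L, WM M0 i j = W0 i j := by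
      intro i hi j hj
      have h1 := WM_eq M0 (Fin.castSucc ⟨i, hi⟩) ⟨j, hj⟩
      have h2 : M0 ⟨j, hj⟩ (Fin.castSucc ⟨i, hi⟩) = W0 i j := by
        simp only [M0, Fin.snoc_castSucc]
      rw [h2] at h1
      exact h1
    have hnn : ∀ i < d, nn p L (WM M0 i) = nn p L (W0 i) := by
      intro i hi
      refine Finset.sum_congr rfl fun j hj => ?_
      rw [hWM0 i hi j (Finset.mem_range.mp hj)]
    have hSS : SS p d L (WM M0) = SS p d L W0 := by
      refine Finset.sum_congr rfl fun r hr => ?_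
      rw [nn_wr, nn_wr]
      refine Finset.sum_congr rfl fun i hi => ?_
      rw [Finset.mem_range] at hr hi
      exact hnn i (by omega)
    have hAdm0 : Adm p f d L (dig p k) (WM M0) := by
      refine ⟨fun i hi => ?_, fun i hi => ?_, fun j hj => ?_⟩
      · rw [hnn i hi]; exact hW0.pos i hi
      · rw [hnn i hi]; exact hW0.dvd i hi
      · refine le_of_eq_of_le (Finset.sum_congr rfl fun i hi => ?_) (hW0.le j hj)
        exact hWM0 i (Finset.mem_range.mp hi) j hj
    have hv0 : vv p Fq M0 ≠ 0 := by
      rw [vv_ne hp hf Fq hcard hM0, adm_iff hM0]; exact hAdm0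
    intro hzero
    have hc := congrArg (fun P => Polynomial.coeff P (EE p M0)) hzero
    simp only [Polynomial.finsetSum_coeff, Polynomial.coeff_C_mul, Polynomial.coeff_X_pow, Polynomial.coeff_zero] at hc
    rw [Finset.sum_eq_single M0] at hc
    · simp at hc; exact hv0 hc
    · intro M hM hne
      by_cases hE : EE p M0 = EE p M
      · by_cases hv : vv p Fq M = 0
        · rw [hv, zero_mul]
        · exfalso
          have hA : Adm p f d L (dig p k) (WM M) := by
            rw [← adm_iff hM, ← vv_ne hp hf Fq hcard hM]; exact hv
          have e1 := EE_SS hkL hM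
          have e0 := EE_SS hkL hM0
          have hu := huniq (WM M) hA (by omega)
          have hcs : ∀ (j : Fin L) (i : Fin d), M j i.castSucc = M0 j i.castSucc := by
            intro j i
            rw [← WM_eq M, ← WM_eq M0]
            exact (hu i i.2 j j.2).trans (hWM0 i i.2 j j.2).symm
          apply hne
          funext j
          have r1 := mem_TT.mp hM j
          have r0 := mem_TT.mp hM0 j
          rw [Fin.sum_univ_castSucc] at r1 r0
          simp only [hcs] at r1
          funext i
          refine Fin.lastCases ?_ (fun i => hcs j i) i
          omega
      · rw [if_neg hE, mul_zero]
    · intro h; exact absurd hM0 h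

end alg
end PS

/-- for `s = -k < 0` and `d ≥ 0`, `S_d(s) = 0` iff `d > L_{-s}`. -/
theorem powerSum_eq_zero_iff
    (p f : ℕ) (hp : p.Prime) (hf : 0 < f)
    (Fq : Type) [Field Fq] [Fintype Fq] (hcard : Fintype.card Fq = p ^ f)
    (k : ℕ) (hk : 0 < k) (d : ℕ) :
    powerSum Fq d k = 0 ↔ Lval p f k hf < (d : ℚ) := by
  have h := PS.psum_ne p f hp hf Fq hcard k hk d
  have hq : (0 : ℚ) < (p : ℚ) ^ f - 1 := by
    have : (1 : ℚ) < (p : ℚ) ^ f := one_lt_pow₀ (by exact_mod_cast hp.one_lt) hf.ne'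
    linarith
  rw [← not_iff_not, not_lt, powerSum]
  refine h.trans ?_
  have h2 : (d : ℚ) ≤ Lval p f k hf ↔ ∀ i ∈ Finset.range f,
      (d : ℚ) ≤ ((Nat.digits (p ^ f) (k * p ^ i)).sum : ℚ) / ((p : ℚ) ^ f - 1) :=
    Finset.le_inf'_iff _ _
  rw [h2]
  simp only [Finset.mem_range]
  refine forall₂_congr fun i _ => ?_
  rw [le_div_iff₀ hq]
  generalize (Nat.digits (p ^ f) (k * p ^ i)).sum = s
  have h3 : ((d : ℚ) * ((p : ℚ) ^ f - 1) ≤ (s : ℚ)) ↔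
      (((d : ℤ) * ((p : ℤ) ^ f - 1) : ℤ) : ℚ) ≤ ((s : ℤ) : ℚ) := by push_cast; rfl
  rw [h3, Int.cast_le]
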